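/- arXiv:2109.06423 — 2 statements merged into one kernel-verified Lean document; each statement's English description precedes it below -/
import Mathlib

section
/- Let N = (N00, N10, N20, N01, N02, N11, N21, N12, N22) be a family of 2D-PI kernels of size n×m with N00 = 0, N10 = 0 and N20 = 0, and suppose each of the kernels N01, N02, N11, N21, N12, N22 has a continuous partial derivative with respect to its second argument y on its whole domain. Define the family M of 2D-PI kernels of size n×m by M00(x,y) = N01(x,y,y) − N02(x,y,y); M10(x,y,θ) = N11(x,y,θ,y) − N12(x,y,θ,y); M20(x,y,θ) = N21(x,y,θ,y) − N22(x,y,θ,y); M01 = ∂ᵧN01; M02 = ∂ᵧN02; M11 = ∂ᵧN11; M21 = ∂ᵧN21; M12 = ∂ᵧN12; M22 = ∂ᵧN22. Then for every continuous u : [a,b]×[c,d] → ℝ^m and every x ∈ [a,b], the function y ↦ (P[N]u)(x,y) is differentiable on [c,d] and its derivative satisfies ∂ᵧ(P[N]u)(x,y) = (P[M]u)(x,y) for all y ∈ [c,d]. -/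
open Matrix MeasureTheory Set

noncomputable section

/-- A family of 1D-PI kernels of size `p × r` (the parameters of a 1D-PI operator). -/
structure PI1DK (p r : ℕ) where
  k0 : ℝ → Matrix (Fin p) (Fin r) ℝ
  k1 : ℝ → ℝ → Matrix (Fin p) (Fin r) ℝ
  k2 : ℝ → ℝ → Matrix (Fin p) (Fin r) ℝ

/-- Continuity of a family of 1D-PI kernels on the interval `[s,t]`. -/
def PI1DK.IsCont {p r : ℕ} (s t : ℝ) (N : PI1DK p r) : Prop :=
  ContinuousOn N.k0 (Icc s t) ∧
  ContinuousOn (fun q : ℝ × ℝ => N.k1 q.1 q.2) (Icc s t ×ˢ Icc s t) ∧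
  ContinuousOn (fun q : ℝ × ℝ => N.k2 q.1 q.2) (Icc s t ×ˢ Icc s t)

/-- The 1D-PI operator on `[s,t]` associated with the kernels `N`. -/
def PI1D {p r : ℕ} (s t : ℝ) (N : PI1DK p r) (u : ℝ → Fin r → ℝ) (x : ℝ) :
    Fin p → ℝ :=
  N.k0 x *ᵥ u x + (∫ θ in s..x, N.k1 x θ *ᵥ u θ) + (∫ θ in x..t, N.k2 x θ *ᵥ u θ)

/-- Entrywise interval integral of a matrix-valued function. -/
def mInt {p r : ℕ} (s t : ℝ) (F : ℝ → Matrix (Fin p) (Fin r) ℝ) :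
    Matrix (Fin p) (Fin r) ℝ :=
  Matrix.of fun i j => ∫ η in s..t, F η i j

/-- A family of 2D-PI kernels of size `p × r`. -/
structure PI2DK (p r : ℕ) where
  k00 : ℝ → ℝ → Matrix (Fin p) (Fin r) ℝ
  k10 : ℝ → ℝ → ℝ → Matrix (Fin p) (Fin r) ℝ
  k20 : ℝ → ℝ → ℝ → Matrix (Fin p) (Fin r) ℝ
  k01 : ℝ → ℝ → ℝ → Matrix (Fin p) (Fin r) ℝ
  k02 : ℝ → ℝ → ℝ → Matrix (Fin p) (Fin r) ℝ
  k11 : ℝ → ℝ → ℝ → ℝ → Matrix (Fin p) (Fin r) ℝ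
  k21 : ℝ → ℝ → ℝ → ℝ → Matrix (Fin p) (Fin r) ℝ
  k12 : ℝ → ℝ → ℝ → ℝ → Matrix (Fin p) (Fin r) ℝ
  k22 : ℝ → ℝ → ℝ → ℝ → Matrix (Fin p) (Fin r) ℝ

/-- Continuity of a family of 2D-PI kernels on `[a,b] × [c,d]`. -/
def PI2DK.IsCont {p r : ℕ} (a b c d : ℝ) (N : PI2DK p r) : Prop :=
  ContinuousOn (fun q : ℝ × ℝ => N.k00 q.1 q.2) (Icc a b ×ˢ Icc c d) ∧
  ContinuousOn (fun q : ℝ × ℝ × ℝ => N.k10 q.1 q.2.1 q.2.2)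
    (Icc a b ×ˢ Icc c d ×ˢ Icc a b) ∧
  ContinuousOn (fun q : ℝ × ℝ × ℝ => N.k20 q.1 q.2.1 q.2.2)
    (Icc a b ×ˢ Icc c d ×ˢ Icc a b) ∧
  ContinuousOn (fun q : ℝ × ℝ × ℝ => N.k01 q.1 q.2.1 q.2.2)
    (Icc a b ×ˢ Icc c d ×ˢ Icc c d) ∧
  ContinuousOn (fun q : ℝ × ℝ × ℝ => N.k02 q.1 q.2.1 q.2.2)
    (Icc a b ×ˢ Icc c d ×ˢ Icc c d) ∧
  ContinuousOn (fun q : ℝ × ℝ × ℝ × ℝ => N.k11 q.1 q.2.1 q.2.2.1 q.2.2.2)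
    (Icc a b ×ˢ Icc c d ×ˢ Icc a b ×ˢ Icc c d) ∧
  ContinuousOn (fun q : ℝ × ℝ × ℝ × ℝ => N.k21 q.1 q.2.1 q.2.2.1 q.2.2.2)
    (Icc a b ×ˢ Icc c d ×ˢ Icc a b ×ˢ Icc c d) ∧
  ContinuousOn (fun q : ℝ × ℝ × ℝ × ℝ => N.k12 q.1 q.2.1 q.2.2.1 q.2.2.2)
    (Icc a b ×ˢ Icc c d ×ˢ Icc a b ×ˢ Icc c d) ∧
  ContinuousOn (fun q : ℝ × ℝ × ℝ × ℝ => N.k22 q.1 q.2.1 q.2.2.1 q.2.2.2)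
    (Icc a b ×ˢ Icc c d ×ˢ Icc a b ×ˢ Icc c d)

/-- The 2D-PI operator on `[a,b] × [c,d]` associated with the kernels `N`. -/
def PI2D {p r : ℕ} (a b c d : ℝ) (N : PI2DK p r) (u : ℝ → ℝ → Fin r → ℝ)
    (x y : ℝ) : Fin p → ℝ :=
  N.k00 x y *ᵥ u x y
  + (∫ θ in a..x, N.k10 x y θ *ᵥ u θ y)
  + (∫ θ in x..b, N.k20 x y θ *ᵥ u θ y)
  + (∫ ν in c..y, N.k01 x y ν *ᵥ u x ν)
  + (∫ ν in y..d, N.k02 x y ν *ᵥ u x ν)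
  + (∫ θ in a..x, ∫ ν in c..y, N.k11 x y θ ν *ᵥ u θ ν)
  + (∫ θ in x..b, ∫ ν in c..y, N.k21 x y θ ν *ᵥ u θ ν)
  + (∫ θ in a..x, ∫ ν in y..d, N.k12 x y θ ν *ᵥ u θ ν)
  + (∫ θ in x..b, ∫ ν in y..d, N.k22 x y θ ν *ᵥ u θ ν)

/-- A family of 011-PI kernels of size `(p0,p1) × (r0,r1)`. -/
structure PI011K (p0 p1 r0 r1 : ℕ) where
  b00 : Matrix (Fin p0) (Fin r0) ℝ
  b01 : ℝ → Matrix (Fin p0) (Fin r1) ℝ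
  b02 : ℝ → Matrix (Fin p0) (Fin r1) ℝ
  b10 : ℝ → Matrix (Fin p1) (Fin r0) ℝ
  b20 : ℝ → Matrix (Fin p1) (Fin r0) ℝ
  b12 : ℝ → ℝ → Matrix (Fin p1) (Fin r1) ℝ
  b21 : ℝ → ℝ → Matrix (Fin p1) (Fin r1) ℝ
  b11 : PI1DK p1 r1
  b22 : PI1DK p1 r1

/-- Continuity of a family of 011-PI kernels. -/
def PI011K.IsCont {p0 p1 r0 r1 : ℕ} (a b c d : ℝ) (B : PI011K p0 p1 r0 r1) : Prop :=
  ContinuousOn B.b01 (Icc a b) ∧ ContinuousOn B.b02 (Icc c d) ∧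
  ContinuousOn B.b10 (Icc a b) ∧ ContinuousOn B.b20 (Icc c d) ∧
  ContinuousOn (fun q : ℝ × ℝ => B.b12 q.1 q.2) (Icc a b ×ˢ Icc c d) ∧
  ContinuousOn (fun q : ℝ × ℝ => B.b21 q.1 q.2) (Icc c d ×ˢ Icc a b) ∧
  B.b11.IsCont a b ∧ B.b22.IsCont c d

/-- The 011-PI operator associated with the kernels `B`. -/
def PI011 {p0 p1 r0 r1 : ℕ} (a b c d : ℝ) (B : PI011K p0 p1 r0 r1)
    (v : Fin r0 → ℝ) (u1 u2 : ℝ → Fin r1 → ℝ) :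
    (Fin p0 → ℝ) × (ℝ → Fin p1 → ℝ) × (ℝ → Fin p1 → ℝ) :=
  ( B.b00 *ᵥ v + (∫ θ in a..b, B.b01 θ *ᵥ u1 θ) + (∫ ν in c..d, B.b02 ν *ᵥ u2 ν),
    fun x => B.b10 x *ᵥ v + PI1D a b B.b11 u1 x + (∫ ν in c..d, B.b12 x ν *ᵥ u2 ν),
    fun y => B.b20 y *ᵥ v + (∫ θ in a..b, B.b21 y θ *ᵥ u1 θ) + PI1D c d B.b22 u2 y )

/-- A family of (2D→011)-PI kernels of size `(p0,p1) × r`. -/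
structure PI2Dto011K (p0 p1 r : ℕ) where
  d0 : ℝ → ℝ → Matrix (Fin p0) (Fin r) ℝ
  d10 : ℝ → ℝ → Matrix (Fin p1) (Fin r) ℝ
  d11 : ℝ → ℝ → ℝ → Matrix (Fin p1) (Fin r) ℝ
  d12 : ℝ → ℝ → ℝ → Matrix (Fin p1) (Fin r) ℝ
  d20 : ℝ → ℝ → Matrix (Fin p1) (Fin r) ℝ
  d21 : ℝ → ℝ → ℝ → Matrix (Fin p1) (Fin r) ℝ
  d22 : ℝ → ℝ → ℝ → Matrix (Fin p1) (Fin r) ℝ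

/-- Continuity of a family of (2D→011)-PI kernels. -/
def PI2Dto011K.IsCont {p0 p1 r : ℕ} (a b c d : ℝ) (D : PI2Dto011K p0 p1 r) : Prop :=
  ContinuousOn (fun q : ℝ × ℝ => D.d0 q.1 q.2) (Icc a b ×ˢ Icc c d) ∧
  ContinuousOn (fun q : ℝ × ℝ => D.d10 q.1 q.2) (Icc a b ×ˢ Icc c d) ∧
  ContinuousOn (fun q : ℝ × ℝ × ℝ => D.d11 q.1 q.2.1 q.2.2)
    (Icc a b ×ˢ Icc c d ×ˢ Icc a b) ∧
  ContinuousOn (fun q : ℝ × ℝ × ℝ => D.d12 q.1 q.2.1 q.2.2)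
    (Icc a b ×ˢ Icc c d ×ˢ Icc a b) ∧
  ContinuousOn (fun q : ℝ × ℝ => D.d20 q.1 q.2) (Icc a b ×ˢ Icc c d) ∧
  ContinuousOn (fun q : ℝ × ℝ × ℝ => D.d21 q.1 q.2.1 q.2.2)
    (Icc a b ×ˢ Icc c d ×ˢ Icc c d) ∧
  ContinuousOn (fun q : ℝ × ℝ × ℝ => D.d22 q.1 q.2.1 q.2.2)
    (Icc a b ×ˢ Icc c d ×ˢ Icc c d)

/-- The (2D→011)-PI operator associated with the kernels `D`. -/
def PI2Dto011 {p0 p1 r : ℕ} (a b c d : ℝ) (D : PI2Dto011K p0 p1 r)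
    (u : ℝ → ℝ → Fin r → ℝ) :
    (Fin p0 → ℝ) × (ℝ → Fin p1 → ℝ) × (ℝ → Fin p1 → ℝ) :=
  ( ∫ θ in a..b, ∫ ν in c..d, D.d0 θ ν *ᵥ u θ ν,
    fun x => ∫ y in c..d,
      (D.d10 x y *ᵥ u x y + (∫ θ in a..x, D.d11 x y θ *ᵥ u θ y)
        + (∫ θ in x..b, D.d12 x y θ *ᵥ u θ y)),
    fun y => ∫ x in a..b,
      (D.d20 x y *ᵥ u x y + (∫ ν in c..y, D.d21 x y ν *ᵥ u x ν)
        + (∫ ν in y..d, D.d22 x y ν *ᵥ u x ν)) )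

/-- A family of (011→2D)-PI kernels of size `p × (r0,r1)`. -/
structure PI011to2DK (p r0 r1 : ℕ) where
  e0 : ℝ → ℝ → Matrix (Fin p) (Fin r0) ℝ
  e10 : ℝ → ℝ → Matrix (Fin p) (Fin r1) ℝ
  e11 : ℝ → ℝ → ℝ → Matrix (Fin p) (Fin r1) ℝ
  e12 : ℝ → ℝ → ℝ → Matrix (Fin p) (Fin r1) ℝ
  e20 : ℝ → ℝ → Matrix (Fin p) (Fin r1) ℝ
  e21 : ℝ → ℝ → ℝ → Matrix (Fin p) (Fin r1) ℝ
  e22 : ℝ → ℝ → ℝ → Matrix (Fin p) (Fin r1) ℝ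

/-- Continuity of a family of (011→2D)-PI kernels. -/
def PI011to2DK.IsCont {p r0 r1 : ℕ} (a b c d : ℝ) (E : PI011to2DK p r0 r1) : Prop :=
  ContinuousOn (fun q : ℝ × ℝ => E.e0 q.1 q.2) (Icc a b ×ˢ Icc c d) ∧
  ContinuousOn (fun q : ℝ × ℝ => E.e10 q.1 q.2) (Icc a b ×ˢ Icc c d) ∧
  ContinuousOn (fun q : ℝ × ℝ × ℝ => E.e11 q.1 q.2.1 q.2.2)
    (Icc a b ×ˢ Icc c d ×ˢ Icc a b) ∧
  ContinuousOn (fun q : ℝ × ℝ × ℝ => E.e12 q.1 q.2.1 q.2.2)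
    (Icc a b ×ˢ Icc c d ×ˢ Icc a b) ∧
  ContinuousOn (fun q : ℝ × ℝ => E.e20 q.1 q.2) (Icc a b ×ˢ Icc c d) ∧
  ContinuousOn (fun q : ℝ × ℝ × ℝ => E.e21 q.1 q.2.1 q.2.2)
    (Icc a b ×ˢ Icc c d ×ˢ Icc c d) ∧
  ContinuousOn (fun q : ℝ × ℝ × ℝ => E.e22 q.1 q.2.1 q.2.2)
    (Icc a b ×ˢ Icc c d ×ˢ Icc c d)

/-- The (011→2D)-PI operator associated with the kernels `E`. -/
def PI011to2D {p r0 r1 : ℕ} (a b c d : ℝ) (E : PI011to2DK p r0 r1)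
    (v : Fin r0 → ℝ) (u1 u2 : ℝ → Fin r1 → ℝ) (x y : ℝ) : Fin p → ℝ :=
  E.e0 x y *ᵥ v + E.e10 x y *ᵥ u1 x
  + (∫ θ in a..x, E.e11 x y θ *ᵥ u1 θ) + (∫ θ in x..b, E.e12 x y θ *ᵥ u1 θ)
  + E.e20 x y *ᵥ u2 y
  + (∫ ν in c..y, E.e21 x y ν *ᵥ u2 ν) + (∫ ν in y..d, E.e22 x y ν *ᵥ u2 ν)

section ParametricIntegrals

open intervalIntegral

variable {E : Type*} [NormedAddCommGroup E] [NormedSpace ℝ E]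

/-- Differentiation under the integral sign over a fixed interval. -/
theorem hasDerivAt_intervalIntegral_of_continuous {f f' : ℝ → ℝ → E}
    (hf : Continuous fun q : ℝ × ℝ => f q.1 q.2) (hf' : Continuous fun q : ℝ × ℝ => f' q.1 q.2)
    (hd : ∀ t ν, HasDerivAt (fun t => f t ν) (f' t ν) t) (p q y : ℝ) :
    HasDerivAt (fun t => ∫ ν in p..q, f t ν) (∫ ν in p..q, f' y ν) y := by
  obtain ⟨C, hC⟩ := ((isCompact_Icc (a := y - 1) (b := y + 1)).prod
    (isCompact_uIcc (a := p) (b := q))).exists_bound_of_continuousOn hf'.continuousOn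
  have hfc : ∀ t, Continuous (f t) := fun t => hf.comp (by fun_prop : Continuous fun ν => (t, ν))
  have hfc' : Continuous (f' y) := hf'.comp (by fun_prop : Continuous fun ν => (y, ν))
  refine (hasDerivAt_integral_of_dominated_loc_of_deriv_le (bound := fun _ => C)
    (Icc_mem_nhds (by linarith : y - 1 < y) (by linarith : y < y + 1))
    (Filter.Eventually.of_forall fun t => (hfc t).aestronglyMeasurable)
    ((hfc y).intervalIntegrable _ _) hfc'.aestronglyMeasurable ?_ (by simp)
    (Filter.Eventually.of_forall fun ν _ t _ => hd t ν)).2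
  exact Filter.Eventually.of_forall fun ν hν t ht => hC (t, ν) ⟨ht, uIoc_subset_uIcc hν⟩

/-- Leibniz rule with a variable upper limit. -/
theorem hasDerivAt_intervalIntegral_upper_of_continuous [CompleteSpace E] {f f' : ℝ → ℝ → E}
    (hf : Continuous fun q : ℝ × ℝ => f q.1 q.2) (hf' : Continuous fun q : ℝ × ℝ => f' q.1 q.2)
    (hd : ∀ t ν, HasDerivAt (fun t => f t ν) (f' t ν) t) (s y : ℝ) :
    HasDerivAt (fun t => ∫ ν in s..t, f t ν) (f y y + ∫ ν in s..y, f' y ν) y := by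
  have hfc : ∀ t, Continuous (f t) := fun t => hf.comp (by fun_prop : Continuous fun ν => (t, ν))
  have key := hasStrictFDerivAt_uncurry_coprod (𝕜 := ℝ) (u := (y, y))
    (f := fun t e => ∫ ν in s..e, f t ν)
    (f₁ := fun t e => ContinuousLinearMap.toSpanSingleton ℝ (∫ ν in s..e, f' t ν))
    (f₂ := fun t e => ContinuousLinearMap.toSpanSingleton ℝ (f t e))
    (Filter.Eventually.of_forall fun v =>
      (hasDerivAt_intervalIntegral_of_continuous hf hf' hd s v.2 v.1).hasFDerivAt)
    (Filter.Eventually.of_forall fun v =>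
      ((hfc v.1).integral_hasStrictDerivAt s v.2).hasDerivAt.hasFDerivAt)
    (Continuous.continuousAt <|
      (ContinuousLinearMap.toSpanSingletonCLE (𝕜 := ℝ) (E := E)).continuous.comp
        (continuous_parametric_primitive_of_continuous hf'))
    (Continuous.continuousAt <|
      (ContinuousLinearMap.toSpanSingletonCLE (𝕜 := ℝ) (E := E)).continuous.comp hf)
  have h := key.hasFDerivAt.comp_hasDerivAt_of_eq y
    ((hasDerivAt_id y).prodMk (hasDerivAt_id y)) rfl
  exact h.congr_deriv (by simp [Function.HasUncurry.uncurry, add_comm])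

/-- A function that is `C¹` in its first variable on `[c,d] × S` extends to a globally `C¹` one when
`S` is a retract of the parameter space. -/
theorem exists_hasDerivAt_extension [CompleteSpace E] {P : Type*} [TopologicalSpace P]
    [FirstCountableTopology P] {c d : ℝ} (hcd : c ≤ d) {S : Set P} {r : P → P} (hr : Continuous r)
    (hrS : ∀ p, r p ∈ S) (hrid : ∀ p ∈ S, r p = p) {f f' : ℝ → P → E}
    (hf : ContinuousOn (fun q : ℝ × P => f q.1 q.2) (Icc c d ×ˢ S))
    (hf' : ContinuousOn (fun q : ℝ × P => f' q.1 q.2) (Icc c d ×ˢ S))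
    (hd : ∀ p ∈ S, ∀ t ∈ Icc c d, HasDerivWithinAt (fun t => f t p) (f' t p) (Icc c d) t) :
    ∃ g g' : ℝ → P → E, (Continuous fun q : ℝ × P => g q.1 q.2) ∧
      (Continuous fun q : ℝ × P => g' q.1 q.2) ∧
      (∀ t p, HasDerivAt (fun t => g t p) (g' t p) t) ∧
      (∀ t ∈ Icc c d, ∀ p ∈ S, g t p = f t p) ∧ (∀ t ∈ Icc c d, ∀ p ∈ S, g' t p = f' t p) := by
  let g' : ℝ → P → E := fun t p => f' (projIcc c d hcd t) (r p)
  have hg' : Continuous fun q : ℝ × P => g' q.1 q.2 :=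
    hf'.comp_continuous
      (f := fun q : ℝ × P => ((projIcc c d hcd q.1 : ℝ), r q.2))
      (((continuous_subtype_val.comp continuous_projIcc).comp continuous_fst).prodMk
        (hr.comp continuous_snd)) fun q => ⟨(projIcc c d hcd q.1).2, hrS _⟩
  have hgp : ∀ p, Continuous fun t => g' t p := fun p =>
    hg'.comp (by fun_prop : Continuous fun t : ℝ => (t, p))
  have heq' : ∀ t ∈ Icc c d, ∀ p ∈ S, g' t p = f' t p := by
    intro t ht p hp
    simp only [g', hrid p hp, projIcc_of_mem hcd ht]
  refine ⟨fun t p => f c (r p) + ∫ τ in c..t, g' τ p, g', ?_, hg', ?_, ?_, heq'⟩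
  · refine Continuous.add ?_ ?_
    · exact hf.comp_continuous (f := fun q : ℝ × P => (c, r q.2)) (by fun_prop)
        fun q => ⟨left_mem_Icc.2 hcd, hrS _⟩
    · have := continuous_parametric_primitive_of_continuous (μ := volume) (a₀ := c)
        (f := fun p τ => g' τ p) (hg'.comp continuous_swap)
      exact this.comp continuous_swap
  · intro t p
    exact ((hgp p).integral_hasStrictDerivAt c t).hasDerivAt.const_add _
  · intro t ht p hp
    have hsub : Icc c t ⊆ Icc c d := Icc_subset_Icc_right ht.2
    have h := integral_eq_sub_of_hasDerivAt_of_le (f := fun τ => f τ p) (f' := fun τ => g' τ p) ht.1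
      (fun τ hτ => ((hd p hp τ (hsub hτ)).continuousWithinAt).mono hsub)
      (fun τ hτ => by
        have hτ' : τ ∈ Icc c d := hsub (Ioo_subset_Icc_self hτ)
        rw [heq' τ hτ' p hp]
        exact (hd p hp τ hτ').hasDerivAt (Icc_mem_nhds hτ.1 (hτ.2.trans_le ht.2)))
      ((hgp p).intervalIntegrable _ _)
    simp only [h, hrid p hp]
    abel

/-- Leibniz rule on a compact interval: variable upper limit, fixed lower limit. -/
theorem hasDerivWithinAt_intervalIntegral_upper [CompleteSpace E] {c d s y : ℝ}
    (hs : s ∈ Icc c d) (hy : y ∈ Icc c d) {f f' : ℝ → ℝ → E}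
    (hf : ContinuousOn (fun q : ℝ × ℝ => f q.1 q.2) (Icc c d ×ˢ Icc c d))
    (hf' : ContinuousOn (fun q : ℝ × ℝ => f' q.1 q.2) (Icc c d ×ˢ Icc c d))
    (hd : ∀ ν ∈ Icc c d, ∀ t ∈ Icc c d,
      HasDerivWithinAt (fun t => f t ν) (f' t ν) (Icc c d) t) :
    HasDerivWithinAt (fun t => ∫ ν in s..t, f t ν) (f y y + ∫ ν in s..y, f' y ν)
      (Icc c d) y := by
  have hcd : c ≤ d := hs.1.trans hs.2
  obtain ⟨g, g', hg, hg', hgd, heq, heq'⟩ := exists_hasDerivAt_extension hcd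
    (r := fun p => (projIcc c d hcd p : ℝ)) (continuous_subtype_val.comp continuous_projIcc)
    (fun p => (projIcc c d hcd p).2) (fun p hp => by simp [projIcc_of_mem hcd hp]) hf hf' hd
  have h := (hasDerivAt_intervalIntegral_upper_of_continuous hg hg' hgd s y).hasDerivWithinAt
    (s := Icc c d)
  rw [heq y hy y hy, integral_congr fun ν hν =>
    heq' y hy ν (uIcc_subset_Icc hs hy hν)] at h
  refine h.congr_of_mem (fun t ht => ?_) hy
  exact integral_congr fun ν hν => (heq t ht ν (uIcc_subset_Icc hs ht hν)).symm

/-- Leibniz rule for an iterated integral over a rectangle with one moving side. -/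
theorem hasDerivWithinAt_integral_integral_upper [CompleteSpace E] {a b c d p q s y : ℝ}
    (hp : p ∈ Icc a b) (hq : q ∈ Icc a b) (hs : s ∈ Icc c d) (hy : y ∈ Icc c d)
    {f f' : ℝ → ℝ → ℝ → E}
    (hf : ContinuousOn (fun q : ℝ × ℝ × ℝ => f q.1 q.2.1 q.2.2) (Icc c d ×ˢ Icc a b ×ˢ Icc c d))
    (hf' : ContinuousOn (fun q : ℝ × ℝ × ℝ => f' q.1 q.2.1 q.2.2) (Icc c d ×ˢ Icc a b ×ˢ Icc c d))
    (hd : ∀ θ ∈ Icc a b, ∀ ν ∈ Icc c d, ∀ t ∈ Icc c d,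
      HasDerivWithinAt (fun t => f t θ ν) (f' t θ ν) (Icc c d) t) :
    HasDerivWithinAt (fun t => ∫ θ in p..q, ∫ ν in s..t, f t θ ν)
      ((∫ θ in p..q, f y θ y) + ∫ θ in p..q, ∫ ν in s..y, f' y θ ν) (Icc c d) y := by
  have hcd : c ≤ d := hs.1.trans hs.2
  have hab : a ≤ b := hp.1.trans hp.2
  obtain ⟨g, g', hg, hg', hgd, heq, heq'⟩ := exists_hasDerivAt_extension
    (S := Icc a b ×ˢ Icc c d) (f := fun t q => f t q.1 q.2) (f' := fun t q => f' t q.1 q.2) hcd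
    (r := fun p => ((projIcc a b hab p.1 : ℝ), (projIcc c d hcd p.2 : ℝ)))
    (((continuous_subtype_val.comp continuous_projIcc).comp continuous_fst).prodMk
      ((continuous_subtype_val.comp continuous_projIcc).comp continuous_snd))
    (fun p => ⟨(projIcc a b hab p.1).2, (projIcc c d hcd p.2).2⟩)
    (fun p hp => by simp [projIcc_of_mem hab hp.1, projIcc_of_mem hcd hp.2]) hf hf'
    (fun p hp => hd p.1 hp.1 p.2 hp.2)
  have hInt : ∀ h : ℝ → ℝ × ℝ → E, (Continuous fun q : ℝ × ℝ × ℝ => h q.1 q.2) →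
      Continuous fun z : ℝ × ℝ => ∫ ν in s..z.1, h z.1 (z.2, ν) := fun h hh =>
    continuous_parametric_intervalIntegral_of_continuous (f := fun (z : ℝ × ℝ) ν => h z.1 (z.2, ν))
      (hh.comp (by fun_prop : Continuous fun w : (ℝ × ℝ) × ℝ => (w.1.1, w.1.2, w.2)))
      continuous_fst
  have hdiag : Continuous fun z : ℝ × ℝ => g z.1 (z.2, z.1) :=
    hg.comp (by fun_prop : Continuous fun z : ℝ × ℝ => (z.1, z.2, z.1))
  have hy' : Continuous fun θ : ℝ => (y, θ) := by fun_prop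
  have h := (hasDerivAt_intervalIntegral_of_continuous
    (f := fun t θ => ∫ ν in s..t, g t (θ, ν))
    (f' := fun t θ => g t (θ, t) + ∫ ν in s..t, g' t (θ, ν)) (hInt g hg)
    (hdiag.add (hInt g' hg'))
    (fun t θ => hasDerivAt_intervalIntegral_upper_of_continuous
      (f := fun t ν => g t (θ, ν)) (f' := fun t ν => g' t (θ, ν))
      (hg.comp (by fun_prop : Continuous fun z : ℝ × ℝ => (z.1, θ, z.2)))
      (hg'.comp (by fun_prop : Continuous fun z : ℝ × ℝ => (z.1, θ, z.2)))
      (fun t ν => hgd t (θ, ν)) s t) p q y).hasDerivWithinAt (s := Icc c d)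
  have hadd := integral_add (μ := volume) ((hdiag.comp hy').intervalIntegrable p q)
    (((hInt g' hg').comp hy').intervalIntegrable p q)
  simp only [Function.comp_apply] at hadd
  rw [hadd] at h
  have hθ : ∀ θ ∈ uIcc p q, θ ∈ Icc a b := fun θ h => uIcc_subset_Icc hp hq h
  rw [integral_congr fun θ h => heq y hy (θ, y) ⟨hθ θ h, hy⟩,
    integral_congr fun θ h => integral_congr fun ν hν =>
      heq' y hy (θ, ν) ⟨hθ θ h, uIcc_subset_Icc hs hy hν⟩] at h
  refine h.congr_of_mem (fun t ht => ?_) hy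
  exact integral_congr fun θ h => integral_congr fun ν hν =>
    (heq t ht (θ, ν) ⟨hθ θ h, uIcc_subset_Icc hs ht hν⟩).symm

theorem hasDerivWithinAt_mulVec {n m : ℕ} {A : ℝ → Matrix (Fin n) (Fin m) ℝ}
    {A' : Matrix (Fin n) (Fin m) ℝ} {s : Set ℝ} {y : ℝ}
    (h : ∀ i j, HasDerivWithinAt (fun t => A t i j) (A' i j) s y) (v : Fin m → ℝ) :
    HasDerivWithinAt (fun t => A t *ᵥ v) (A' *ᵥ v) s y := by
  rw [hasDerivWithinAt_pi]
  intro i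
  simp only [mulVec, dotProduct]
  exact HasDerivWithinAt.fun_sum fun j _ => (h i j).mul_const _

theorem continuousOn_mulVec {X : Type*} [TopologicalSpace X] {n m : ℕ}
    {A : X → Matrix (Fin n) (Fin m) ℝ} {v : X → Fin m → ℝ} {s : Set X}
    (hA : ContinuousOn A s) (hv : ContinuousOn v s) :
    ContinuousOn (fun x => A x *ᵥ v x) s :=
  (continuous_fst.matrix_mulVec continuous_snd).comp_continuousOn (hA.prodMk hv)

end ParametricIntegrals

/-- Leibniz rule for the single integrals in the `y` direction. -/
theorem hasDerivWithinAt_integral_mulVec {n m : ℕ} {a b c d s x y : ℝ}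
    {K K' : ℝ → ℝ → ℝ → Matrix (Fin n) (Fin m) ℝ} {u : ℝ → ℝ → Fin m → ℝ}
    (hK : ContinuousOn (fun q : ℝ × ℝ × ℝ => K q.1 q.2.1 q.2.2)
      (Icc a b ×ˢ Icc c d ×ˢ Icc c d))
    (hK' : ContinuousOn (fun q : ℝ × ℝ × ℝ => K' q.1 q.2.1 q.2.2)
      (Icc a b ×ˢ Icc c d ×ˢ Icc c d))
    (hd : ∀ x ∈ Icc a b, ∀ ν ∈ Icc c d, ∀ y ∈ Icc c d, ∀ i j,
      HasDerivWithinAt (fun t => K x t ν i j) (K' x y ν i j) (Icc c d) y)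
    (hu : ContinuousOn (fun q : ℝ × ℝ => u q.1 q.2) (Icc a b ×ˢ Icc c d))
    (hs : s ∈ Icc c d) (hx : x ∈ Icc a b) (hy : y ∈ Icc c d) :
    HasDerivWithinAt (fun t => ∫ ν in s..t, K x t ν *ᵥ u x ν)
      (K x y y *ᵥ u x y + ∫ ν in s..y, K' x y ν *ᵥ u x ν) (Icc c d) y := by
  have hu' : ContinuousOn (fun q : ℝ × ℝ => u x q.2) (Icc c d ×ˢ Icc c d) :=
    hu.comp (f := fun q : ℝ × ℝ => (x, q.2)) (by fun_prop) fun q hq => ⟨hx, hq.2⟩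
  have hC : ∀ L : ℝ → ℝ → ℝ → Matrix (Fin n) (Fin m) ℝ,
      ContinuousOn (fun q : ℝ × ℝ × ℝ => L q.1 q.2.1 q.2.2) (Icc a b ×ˢ Icc c d ×ˢ Icc c d) →
      ContinuousOn (fun q : ℝ × ℝ => L x q.1 q.2 *ᵥ u x q.2) (Icc c d ×ˢ Icc c d) :=
    fun L hL => continuousOn_mulVec
      (hL.comp (f := fun q : ℝ × ℝ => (x, q.1, q.2)) (by fun_prop) fun q hq => ⟨hx, hq.1, hq.2⟩) hu'
  exact hasDerivWithinAt_intervalIntegral_upper (f := fun t ν => K x t ν *ᵥ u x ν)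
    (f' := fun t ν => K' x t ν *ᵥ u x ν) hs hy (hC K hK) (hC K' hK')
    fun ν hν t ht => hasDerivWithinAt_mulVec (hd x hx ν hν t ht) _

/-- Leibniz rule for the double integrals. -/
theorem hasDerivWithinAt_integral_integral_mulVec {n m : ℕ} {a b c d p q s x y : ℝ}
    {K K' : ℝ → ℝ → ℝ → ℝ → Matrix (Fin n) (Fin m) ℝ} {u : ℝ → ℝ → Fin m → ℝ}
    (hK : ContinuousOn (fun q : ℝ × ℝ × ℝ × ℝ => K q.1 q.2.1 q.2.2.1 q.2.2.2)
      (Icc a b ×ˢ Icc c d ×ˢ Icc a b ×ˢ Icc c d))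
    (hK' : ContinuousOn (fun q : ℝ × ℝ × ℝ × ℝ => K' q.1 q.2.1 q.2.2.1 q.2.2.2)
      (Icc a b ×ˢ Icc c d ×ˢ Icc a b ×ˢ Icc c d))
    (hd : ∀ x ∈ Icc a b, ∀ θ ∈ Icc a b, ∀ ν ∈ Icc c d, ∀ y ∈ Icc c d, ∀ i j,
      HasDerivWithinAt (fun t => K x t θ ν i j) (K' x y θ ν i j) (Icc c d) y)
    (hu : ContinuousOn (fun q : ℝ × ℝ => u q.1 q.2) (Icc a b ×ˢ Icc c d))
    (hp : p ∈ Icc a b) (hq : q ∈ Icc a b) (hs : s ∈ Icc c d) (hx : x ∈ Icc a b)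
    (hy : y ∈ Icc c d) :
    HasDerivWithinAt (fun t => ∫ θ in p..q, ∫ ν in s..t, K x t θ ν *ᵥ u θ ν)
      ((∫ θ in p..q, K x y θ y *ᵥ u θ y)
        + ∫ θ in p..q, ∫ ν in s..y, K' x y θ ν *ᵥ u θ ν) (Icc c d) y := by
  have hC : ∀ L : ℝ → ℝ → ℝ → ℝ → Matrix (Fin n) (Fin m) ℝ,
      ContinuousOn (fun q : ℝ × ℝ × ℝ × ℝ => L q.1 q.2.1 q.2.2.1 q.2.2.2)
        (Icc a b ×ˢ Icc c d ×ˢ Icc a b ×ˢ Icc c d) →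
      ContinuousOn (fun q : ℝ × ℝ × ℝ => L x q.1 q.2.1 q.2.2 *ᵥ u q.2.1 q.2.2)
        (Icc c d ×ˢ Icc a b ×ˢ Icc c d) :=
    fun L hL => continuousOn_mulVec
      (hL.comp (f := fun q : ℝ × ℝ × ℝ => (x, q)) (by fun_prop) fun q hq => ⟨hx, hq⟩)
      (hu.comp (f := fun q : ℝ × ℝ × ℝ => q.2) (by fun_prop) fun q hq => hq.2)
  exact hasDerivWithinAt_integral_integral_upper (f := fun t θ ν => K x t θ ν *ᵥ u θ ν)
    (f' := fun t θ ν => K' x t θ ν *ᵥ u θ ν) hp hq hs hy (hC K hK) (hC K' hK')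
    fun θ hθ ν hν t ht => hasDerivWithinAt_mulVec (hd x hx θ hθ ν hν t ht) _

/-- Integrability of a diagonal slice of a double-integral kernel. -/
theorem intervalIntegrable_diag_mulVec {n m : ℕ} {a b c d p q x y : ℝ}
    {K : ℝ → ℝ → ℝ → ℝ → Matrix (Fin n) (Fin m) ℝ} {u : ℝ → ℝ → Fin m → ℝ}
    (hK : ContinuousOn (fun q : ℝ × ℝ × ℝ × ℝ => K q.1 q.2.1 q.2.2.1 q.2.2.2)
      (Icc a b ×ˢ Icc c d ×ˢ Icc a b ×ˢ Icc c d))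
    (hu : ContinuousOn (fun q : ℝ × ℝ => u q.1 q.2) (Icc a b ×ˢ Icc c d))
    (hp : p ∈ Icc a b) (hq : q ∈ Icc a b) (hx : x ∈ Icc a b) (hy : y ∈ Icc c d) :
    IntervalIntegrable (fun θ => K x y θ y *ᵥ u θ y) volume p q := by
  have h : ContinuousOn (fun θ => K x y θ y *ᵥ u θ y) (Icc a b) := continuousOn_mulVec
    (hK.comp (f := fun θ : ℝ => (x, y, θ, y)) (by fun_prop) fun θ hθ => ⟨hx, hy, hθ, hy⟩)
    (hu.comp (f := fun θ : ℝ => (θ, y)) (by fun_prop) fun θ hθ => ⟨hθ, hy⟩)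
  exact (h.mono (uIcc_subset_Icc hp hq)).intervalIntegrable

/-- Composition of the differential operator `∂ᵧ` with a 2D-PI operator
having no multiplier terms in the `y` direction is again a 2D-PI operator. -/
theorem partial_y_of_2D_PI_operator {n m : ℕ} (a b c d : ℝ)
    (hab : a < b) (hcd : c < d)
    (N M : PI2DK n m) (hN : N.IsCont a b c d)
    (h00 : ∀ x y, N.k00 x y = 0)
    (h10 : ∀ x y θ, N.k10 x y θ = 0)
    (h20 : ∀ x y θ, N.k20 x y θ = 0)
    -- definition of the multiplier kernels of `M`
    (hM00 : ∀ x y, M.k00 x y = N.k01 x y y - N.k02 x y y)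
    (hM10 : ∀ x y θ, M.k10 x y θ = N.k11 x y θ y - N.k12 x y θ y)
    (hM20 : ∀ x y θ, M.k20 x y θ = N.k21 x y θ y - N.k22 x y θ y)
    -- the remaining kernels of `M` are the partial `y`-derivatives of those of `N`
    (hM01 : ∀ x ∈ Icc a b, ∀ ν ∈ Icc c d, ∀ y ∈ Icc c d, ∀ i j,
      HasDerivWithinAt (fun t => N.k01 x t ν i j) (M.k01 x y ν i j) (Icc c d) y)
    (hM02 : ∀ x ∈ Icc a b, ∀ ν ∈ Icc c d, ∀ y ∈ Icc c d, ∀ i j,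
      HasDerivWithinAt (fun t => N.k02 x t ν i j) (M.k02 x y ν i j) (Icc c d) y)
    (hM11 : ∀ x ∈ Icc a b, ∀ θ ∈ Icc a b, ∀ ν ∈ Icc c d, ∀ y ∈ Icc c d, ∀ i j,
      HasDerivWithinAt (fun t => N.k11 x t θ ν i j) (M.k11 x y θ ν i j) (Icc c d) y)
    (hM21 : ∀ x ∈ Icc a b, ∀ θ ∈ Icc a b, ∀ ν ∈ Icc c d, ∀ y ∈ Icc c d, ∀ i j,
      HasDerivWithinAt (fun t => N.k21 x t θ ν i j) (M.k21 x y θ ν i j) (Icc c d) y)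
    (hM12 : ∀ x ∈ Icc a b, ∀ θ ∈ Icc a b, ∀ ν ∈ Icc c d, ∀ y ∈ Icc c d, ∀ i j,
      HasDerivWithinAt (fun t => N.k12 x t θ ν i j) (M.k12 x y θ ν i j) (Icc c d) y)
    (hM22 : ∀ x ∈ Icc a b, ∀ θ ∈ Icc a b, ∀ ν ∈ Icc c d, ∀ y ∈ Icc c d, ∀ i j,
      HasDerivWithinAt (fun t => N.k22 x t θ ν i j) (M.k22 x y θ ν i j) (Icc c d) y)
    -- the partial `y`-derivatives are continuous on the whole domain
    (hc01 : ContinuousOn (fun q : ℝ × ℝ × ℝ => M.k01 q.1 q.2.1 q.2.2)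
      (Icc a b ×ˢ Icc c d ×ˢ Icc c d))
    (hc02 : ContinuousOn (fun q : ℝ × ℝ × ℝ => M.k02 q.1 q.2.1 q.2.2)
      (Icc a b ×ˢ Icc c d ×ˢ Icc c d))
    (hc11 : ContinuousOn (fun q : ℝ × ℝ × ℝ × ℝ => M.k11 q.1 q.2.1 q.2.2.1 q.2.2.2)
      (Icc a b ×ˢ Icc c d ×ˢ Icc a b ×ˢ Icc c d))
    (hc21 : ContinuousOn (fun q : ℝ × ℝ × ℝ × ℝ => M.k21 q.1 q.2.1 q.2.2.1 q.2.2.2)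
      (Icc a b ×ˢ Icc c d ×ˢ Icc a b ×ˢ Icc c d))
    (hc12 : ContinuousOn (fun q : ℝ × ℝ × ℝ × ℝ => M.k12 q.1 q.2.1 q.2.2.1 q.2.2.2)
      (Icc a b ×ˢ Icc c d ×ˢ Icc a b ×ˢ Icc c d))
    (hc22 : ContinuousOn (fun q : ℝ × ℝ × ℝ × ℝ => M.k22 q.1 q.2.1 q.2.2.1 q.2.2.2)
      (Icc a b ×ˢ Icc c d ×ˢ Icc a b ×ˢ Icc c d)) :
    ∀ u : ℝ → ℝ → Fin m → ℝ,
      ContinuousOn (fun q : ℝ × ℝ => u q.1 q.2) (Icc a b ×ˢ Icc c d) →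
      ∀ x ∈ Icc a b, ∀ y ∈ Icc c d,
        HasDerivWithinAt (fun t => PI2D a b c d N u x t)
          (PI2D a b c d M u x y) (Icc c d) y := by
  intro u hu x hx y hy
  obtain ⟨-, -, -, n01, n02, n11, n21, n12, n22⟩ := hN
  have ha : a ∈ Icc a b := left_mem_Icc.2 hab.le
  have hb : b ∈ Icc a b := right_mem_Icc.2 hab.le
  have hc : c ∈ Icc c d := left_mem_Icc.2 hcd.le
  have hd : d ∈ Icc c d := right_mem_Icc.2 hcd.le
  have d01 := hasDerivWithinAt_integral_mulVec n01 hc01 hM01 hu hc hx hy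
  have d02 := hasDerivWithinAt_integral_mulVec n02 hc02 hM02 hu hd hx hy
  have d11 := hasDerivWithinAt_integral_integral_mulVec n11 hc11 hM11 hu ha hx hc hx hy
  have d21 := hasDerivWithinAt_integral_integral_mulVec n21 hc21 hM21 hu hx hb hc hx hy
  have d12 := hasDerivWithinAt_integral_integral_mulVec n12 hc12 hM12 hu ha hx hd hx hy
  have d22 := hasDerivWithinAt_integral_integral_mulVec n22 hc22 hM22 hu hx hb hd hx hy
  have e10 := intervalIntegral.integral_sub
    (intervalIntegrable_diag_mulVec n11 hu ha hx hx hy)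
    (intervalIntegrable_diag_mulVec n12 hu ha hx hx hy)
  have e20 := intervalIntegral.integral_sub
    (intervalIntegrable_diag_mulVec n21 hu hx hb hx hy)
    (intervalIntegrable_diag_mulVec n22 hu hx hb hx hy)
  have key := ((((d01.sub d02).add d11).add d21).sub d12).sub d22
  refine (key.congr_of_mem (fun t _ => ?_) hy).congr_deriv ?_
  · simp only [PI2D, h00, h10, h20, zero_mulVec, intervalIntegral.integral_zero,
      intervalIntegral.integral_symm d t, intervalIntegral.integral_neg,
      Pi.add_apply, Pi.sub_apply]
    abel
  · simp only [PI2D, hM00, hM10, hM20, sub_mulVec, e10, e20,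
      intervalIntegral.integral_symm d y, intervalIntegral.integral_neg]
    abel
end
end

section
/- Fix real numbers a < b and c < d and n, q ∈ ℕ. Let g : [a,b]×[c,d] → ℝ be continuous with g(x,y) ≥ 0 for all (x,y), and let Z1 : [a,b]×[c,d] → ℝ^{q×n}, Z2, Z3 : [a,b]×[c,d]×[a,b] → ℝ^{q×n}, Z4, Z5 : [a,b]×[c,d]×[c,d] → ℝ^{q×n}, and Z6, Z7, Z8, Z9 : [a,b]×[c,d]×[a,b]×[c,d] → ℝ^{q×n} be continuous. For a continuous u : [a,b]×[c,d] → ℝ^n define (𝒵u)(x,y) ∈ ℝ^{9q} to be √(g(x,y)) times the vertical concatenation of the nine blocks Z1(x,y)u(x,y); ∫_a^x Z2(x,y,θ)u(θ,y)dθ; ∫_x^b Z3(x,y,θ)u(θ,y)dθ; ∫_c^y Z4(x,y,ν)u(x,ν)dν; ∫_y^d Z5(x,y,ν)u(x,ν)dν; ∫_a^x∫_c^y Z6(x,y,θ,ν)u(θ,ν)dν dθ; ∫_x^b∫_c^y Z7(x,y,θ,ν)u(θ,ν)dν dθ; ∫_a^x∫_y^d Z8(x,y,θ,ν)u(θ,ν)dν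 dθ; ∫_x^b∫_y^d Z9(x,y,θ,ν)u(θ,ν)dν dθ. Then for every symmetric positive-semidefinite matrix P ∈ ℝ^{9q×9q} there exists a family N of 2D-PI kernels of size n×n such that for all continuous u, v : [a,b]×[c,d] → ℝ^n, ∫_a^b∫_c^d v(x,y)ᵀ(P[N]u)(x,y) dy dx = ∫_a^b∫_c^d (𝒵v)(x,y)ᵀ P (𝒵u)(x,y) dy dx; in particular, ∫_a^b∫_c^d v(x,y)ᵀ(P[N]u)(x,y) dy dx = ∫_a^b∫_c^d (P[N]v)(x,y)ᵀ u(x,y) dy dx for all such u, v, and ∫_a^b∫_c^d u(x,y)ᵀ(P[N]u)(x,y) dy dx ≥ 0 for every continuous u. -/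
open Matrix MeasureTheory Set

noncomputable section

/-- The operator `𝒵` sending `u` to the weighted vertical concatenation of nine PI blocks
determined by `Z1, …, Z9`, scaled by `√(g(x,y))`. -/
def Zop {n q : ℕ} (a b c d : ℝ) (g : ℝ → ℝ → ℝ)
    (Z1 : ℝ → ℝ → Matrix (Fin q) (Fin n) ℝ)
    (Z2 Z3 Z4 Z5 : ℝ → ℝ → ℝ → Matrix (Fin q) (Fin n) ℝ)
    (Z6 Z7 Z8 Z9 : ℝ → ℝ → ℝ → ℝ → Matrix (Fin q) (Fin n) ℝ)
    (u : ℝ → ℝ → Fin n → ℝ) (x y : ℝ) : Fin 9 × Fin q → ℝ := fun ik =>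
  Real.sqrt (g x y) *
    (![Z1 x y *ᵥ u x y,
       ∫ θ in a..x, Z2 x y θ *ᵥ u θ y,
       ∫ θ in x..b, Z3 x y θ *ᵥ u θ y,
       ∫ ν in c..y, Z4 x y ν *ᵥ u x ν,
       ∫ ν in y..d, Z5 x y ν *ᵥ u x ν,
       ∫ θ in a..x, ∫ ν in c..y, Z6 x y θ ν *ᵥ u θ ν,
       ∫ θ in x..b, ∫ ν in c..y, Z7 x y θ ν *ᵥ u θ ν,
       ∫ θ in a..x, ∫ ν in y..d, Z8 x y θ ν *ᵥ u θ ν,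
       ∫ θ in x..b, ∫ ν in y..d, Z9 x y θ ν *ᵥ u θ ν] : Fin 9 → Fin q → ℝ)
      ik.1 ik.2

section PartialIntegrals

variable {E : Type*} [NormedAddCommGroup E] [NormedSpace ℝ E]

/-- The integral of `f` over the segment from `s` to `t`, in normalized parametrization and with
weight `w`. Evaluations and interval integrals are both of this form. -/
def segInt (w s t : ℝ) (f : ℝ → E) : E :=
  w • ∫ τ in (0 : ℝ)..1, f (s + (t - s) * τ)

theorem segInt_eval (s : ℝ) (f : ℝ → E) [CompleteSpace E] : segInt 1 s s f = f s := by
  simp [segInt]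

theorem segInt_interval (s t : ℝ) (f : ℝ → E) : segInt (t - s) s t f = ∫ x in s..t, f x := by
  simp [segInt, intervalIntegral.smul_integral_comp_add_mul]

theorem segInt_zero (s t : ℝ) (f : ℝ → E) : segInt 0 s t f = 0 := by
  simp [segInt]

theorem segInt_mul_const (w s t : ℝ) (f : ℝ → ℝ) (r : ℝ) :
    segInt w s t (fun x => f x * r) = segInt w s t f * r := by
  simp [segInt, mul_assoc]

theorem segInt_sum {ι : Type*} (A : Finset ι) (w s t : ℝ) (f : ι → ℝ → ℝ)
    (hf : ∀ i ∈ A, Continuous (f i)) :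
    segInt w s t (fun x => ∑ i ∈ A, f i x) = ∑ i ∈ A, segInt w s t (f i) := by
  simp only [segInt]
  rw [intervalIntegral.integral_finsetSum, Finset.smul_sum]
  intro i hi
  have := hf i hi
  exact Continuous.intervalIntegrable (by fun_prop) _ _

@[fun_prop]
theorem Continuous.segInt {X : Type*} [TopologicalSpace X] {w s t : X → ℝ} {f : X → ℝ → E}
    (hw : Continuous w) (hs : Continuous s) (ht : Continuous t)
    (hf : Continuous fun p : X × ℝ => f p.1 p.2) :
    Continuous fun p => segInt (w p) (s p) (t p) (f p) := by
  unfold _root_.segInt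
  refine hw.smul (intervalIntegral.continuous_parametric_intervalIntegral_of_continuous'
    (f := fun p τ => f p (s p + (t p - s p) * τ)) ?_ 0 1)
  exact hf.comp (f := fun z : X × ℝ => (z.1, s z.1 + (t z.1 - s z.1) * z.2)) (by fun_prop)

theorem integrableOn_uIoc_prod {f : ℝ × ℝ → ℝ} (hf : Continuous f) (s t s' t' : ℝ) :
    IntegrableOn f (uIoc s t ×ˢ uIoc s' t') :=
  (hf.continuousOn.integrableOn_compact (isCompact_uIcc.prod isCompact_uIcc)).mono_set
    (prod_mono uIoc_subset_uIcc uIoc_subset_uIcc)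

theorem intervalIntegral_swap_of_continuous {s t s' t' : ℝ} {f : ℝ → ℝ → ℝ}
    (hf : Continuous fun p : ℝ × ℝ => f p.1 p.2) :
    ∫ x in s..t, ∫ y in s'..t', f x y = ∫ y in s'..t', ∫ x in s..t, f x y :=
  intervalIntegral_intervalIntegral_swap (integrableOn_uIoc_prod hf s t s' t')

theorem segInt_swap (w s t w' s' t' : ℝ) {f : ℝ → ℝ → ℝ}
    (hf : Continuous fun p : ℝ × ℝ => f p.1 p.2) :
    segInt w s t (fun x => segInt w' s' t' (fun y => f x y)) =
      segInt w' s' t' (fun y => segInt w s t (fun x => f x y)) := by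
  simp only [segInt, smul_eq_mul, intervalIntegral.integral_const_mul]
  rw [mul_left_comm, intervalIntegral_swap_of_continuous]
  exact hf.comp (f := fun p : ℝ × ℝ => (s + (t - s) * p.1, s' + (t' - s') * p.2)) (by fun_prop)

/-- A point evaluation at `x`, or the integral over `[a,x]`, or the integral over `[x,b]`. -/
def partInt (a b : ℝ) : Fin 3 → ℝ → (ℝ → E) → E
  | 0, x, f => f x
  | 1, x, f => ∫ θ in a..x, f θ
  | 2, x, f => ∫ θ in x..b, f θ

/-- A family of functionals, each being a weighted integral over a segment, with data depending
continuously on two parameters. -/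
def IsSegFamily (R : ℝ → ℝ → (ℝ → ℝ) → ℝ) : Prop :=
  ∃ w l r : ℝ × ℝ → ℝ, Continuous w ∧ Continuous l ∧ Continuous r ∧
    ∀ s t f, R s t f = segInt (w (s, t)) (l (s, t)) (r (s, t)) f

theorem IsSegFamily.zero : IsSegFamily fun _ _ _ => 0 :=
  ⟨0, 0, 0, continuous_const, continuous_const, continuous_const,
    fun _ _ f => (segInt_zero 0 0 f).symm⟩

theorem IsSegFamily.eval {l : ℝ × ℝ → ℝ} (hl : Continuous l) :
    IsSegFamily fun s t f => f (l (s, t)) :=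
  ⟨fun _ => 1, l, l, continuous_const, hl, hl, fun s t f => (segInt_eval (l (s, t)) f).symm⟩

theorem IsSegFamily.interval {l r : ℝ × ℝ → ℝ} (hl : Continuous l) (hr : Continuous r) :
    IsSegFamily fun s t f => ∫ x in l (s, t)..r (s, t), f x :=
  ⟨fun p => r p - l p, l, r, by fun_prop, hl, hr,
    fun s t f => (segInt_interval (l (s, t)) (r (s, t)) f).symm⟩

theorem exists_partInt_eq_segInt [CompleteSpace E] (a b : ℝ) (α : Fin 3) :
    ∃ w s t : ℝ → ℝ, Continuous w ∧ Continuous s ∧ Continuous t ∧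
      ∀ (x : ℝ) (f : ℝ → E), partInt a b α x f = segInt (w x) (s x) (t x) f := by
  match α with
  | 0 => exact ⟨fun _ => 1, id, id, by fun_prop, by fun_prop, by fun_prop,
      fun x f => (segInt_eval x f).symm⟩
  | 1 => exact ⟨fun x => x - a, fun _ => a, id, by fun_prop, by fun_prop, by fun_prop,
      fun x f => (segInt_interval a x f).symm⟩
  | 2 => exact ⟨fun x => b - x, id, fun _ => b, by fun_prop, by fun_prop, by fun_prop,
      fun x f => (segInt_interval x b f).symm⟩

theorem integral_triangle_of_le {s t : ℝ} (hst : s ≤ t) {f : ℝ → ℝ → ℝ}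
    (hf : Continuous fun p : ℝ × ℝ => f p.1 p.2) :
    ∫ x in s..t, ∫ y in s..x, f x y = ∫ y in s..t, ∫ x in y..t, f x y := by
  set D : Set (ℝ × ℝ) := {p | p.2 ≤ p.1}
  have hD : MeasurableSet D := (isClosed_le continuous_snd continuous_fst).measurableSet
  set g : ℝ → ℝ → ℝ := fun x y => D.indicator (fun p => f p.1 p.2) (x, y)
  have hL : ∀ x ∈ uIcc s t, ∫ y in s..x, f x y = ∫ y in s..t, g x y := by
    intro x hx
    rw [uIcc_of_le hst] at hx
    rw [intervalIntegral.integral_of_le hx.1, intervalIntegral.integral_of_le hst]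
    have : ∀ y, g x y = (Iic x).indicator (f x) y := fun y => by
      simp [g, D, indicator]
    simp only [this]
    rw [setIntegral_indicator measurableSet_Iic, Ioc_inter_Iic, min_eq_right hx.2]
  have hR : ∀ y ∈ uIcc s t, ∫ x in y..t, f x y = ∫ x in s..t, g x y := by
    intro y hy
    rw [uIcc_of_le hst] at hy
    rw [intervalIntegral.integral_of_le hy.2, intervalIntegral.integral_of_le hst]
    have : ∀ x, g x y = (Ici y).indicator (fun x => f x y) x := fun x => by
      simp [g, D, indicator]
    simp only [this]
    rw [setIntegral_indicator measurableSet_Ici,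
      ← setIntegral_congr_set ((ae_eq_refl (Ioc s t)).inter Ioi_ae_eq_Ici), Ioc_inter_Ioi,
      max_eq_right hy.1]
  rw [intervalIntegral.integral_congr hL, intervalIntegral.integral_congr hR]
  exact intervalIntegral_intervalIntegral_swap ((integrableOn_uIoc_prod hf s t s t).indicator hD)

theorem integral_triangle (s t : ℝ) {f : ℝ → ℝ → ℝ}
    (hf : Continuous fun p : ℝ × ℝ => f p.1 p.2) :
    ∫ x in s..t, ∫ y in s..x, f x y = ∫ y in s..t, ∫ x in y..t, f x y := by
  rcases le_total s t with h | h
  · exact integral_triangle_of_le h hf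
  · have := integral_triangle_of_le h (f := fun x y => f y x) (by fun_prop)
    rw [intervalIntegral.integral_symm, intervalIntegral.integral_symm t s,
      intervalIntegral.integral_congr (g := fun x => -∫ y in x..s, f x y)
        (fun x _ => intervalIntegral.integral_symm x s),
      intervalIntegral.integral_congr (g := fun y => -∫ x in t..y, f x y)
        (fun y _ => intervalIntegral.integral_symm t y),
      intervalIntegral.integral_neg, intervalIntegral.integral_neg, neg_neg, neg_neg]
    exact this.symm

theorem integral_triangle_upper (s t : ℝ) {f : ℝ → ℝ → ℝ}
    (hf : Continuous fun p : ℝ × ℝ => f p.1 p.2) :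
    ∫ x in s..t, ∫ y in x..t, f x y = ∫ y in s..t, ∫ x in s..y, f x y :=
  (integral_triangle s t (f := fun x y => f y x) (by fun_prop)).symm

theorem continuous_intervalIntegral {X : Type*} [TopologicalSpace X] {s t : X → ℝ}
    {f : X → ℝ → ℝ} (hs : Continuous s) (ht : Continuous t)
    (hf : Continuous fun p : X × ℝ => f p.1 p.2) :
    Continuous fun p => ∫ x in s p..t p, f p x := by
  simp only [← segInt_interval]
  fun_prop

/-- The composition of two partial integrals, integrated over the outer variable `x`, is again a
sum of partial integrals, whose kernels are obtained by integrating out `x`. -/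
theorem exists_integral_partInt_partInt (a b : ℝ) (α' α : Fin 3) :
    ∃ R : Fin 3 → ℝ → ℝ → (ℝ → ℝ) → ℝ, (∀ γ, IsSegFamily (R γ)) ∧
      ∀ F : ℝ → ℝ → ℝ → ℝ, (Continuous fun p : ℝ × ℝ × ℝ => F p.1 p.2.1 p.2.2) →
        ∫ x in a..b, partInt a b α' x (fun s => partInt a b α x fun t => F x s t) =
          ∫ s in a..b, ∑ γ, partInt a b γ s fun t => R γ s t fun x => F x s t := by
  have z := IsSegFamily.zero
  have hfst : Continuous fun p : ℝ × ℝ => p.1 := continuous_fst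
  have hsnd : Continuous fun p : ℝ × ℝ => p.2 := continuous_snd
  have hc (r : ℝ) : Continuous fun _ : ℝ × ℝ => r := continuous_const
  have evs : IsSegFamily fun s _ f => f s := .eval hfst
  have evt : IsSegFamily fun _ t f => f t := .eval hsnd
  match α', α with
  | 0, 0 =>
    refine ⟨![fun s _ f => f s, fun _ _ _ => 0, fun _ _ _ => 0],
      Fin.forall_fin_succ.2 ⟨evs, Fin.forall_fin_two.2 ⟨z, z⟩⟩, fun F hF => ?_⟩
    simp [Fin.sum_univ_three, partInt]
  | 0, 1 =>
    refine ⟨![fun _ _ _ => 0, fun s _ f => f s, fun _ _ _ => 0],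
      Fin.forall_fin_succ.2 ⟨z, Fin.forall_fin_two.2 ⟨evs, z⟩⟩, fun F hF => ?_⟩
    simp [Fin.sum_univ_three, partInt]
  | 0, 2 =>
    refine ⟨![fun _ _ _ => 0, fun _ _ _ => 0, fun s _ f => f s],
      Fin.forall_fin_succ.2 ⟨z, Fin.forall_fin_two.2 ⟨z, evs⟩⟩, fun F hF => ?_⟩
    simp [Fin.sum_univ_three, partInt]
  | 1, 0 =>
    refine ⟨![fun _ _ _ => 0, fun _ _ _ => 0, fun _ t f => f t],
      Fin.forall_fin_succ.2 ⟨z, Fin.forall_fin_two.2 ⟨z, evt⟩⟩, fun F hF => ?_⟩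
    simp only [Fin.sum_univ_three, partInt, cons_val, intervalIntegral.integral_zero, zero_add]
    exact integral_triangle a b
      (hF.comp (f := fun p : ℝ × ℝ => (p.1, p.2, p.1)) (by fun_prop))
  | 2, 0 =>
    refine ⟨![fun _ _ _ => 0, fun _ t f => f t, fun _ _ _ => 0],
      Fin.forall_fin_succ.2 ⟨z, Fin.forall_fin_two.2 ⟨evt, z⟩⟩, fun F hF => ?_⟩
    simp only [Fin.sum_univ_three, partInt, cons_val, intervalIntegral.integral_zero, zero_add,
      add_zero]
    exact integral_triangle_upper a b
      (hF.comp (f := fun p : ℝ × ℝ => (p.1, p.2, p.1)) (by fun_prop))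
  | 1, 2 =>
    refine ⟨![fun _ _ _ => 0, fun _ _ _ => 0, fun s t f => ∫ x in s..t, f x],
      Fin.forall_fin_succ.2 ⟨z, Fin.forall_fin_two.2 ⟨z, .interval hfst hsnd⟩⟩, fun F hF => ?_⟩
    simp only [Fin.sum_univ_three, partInt, cons_val, intervalIntegral.integral_zero, zero_add]
    rw [integral_triangle a b (continuous_intervalIntegral (by fun_prop) (by fun_prop)
      (hF.comp (f := fun p : (ℝ × ℝ) × ℝ => (p.1.1, p.1.2, p.2)) (by fun_prop)))]
    refine intervalIntegral.integral_congr fun s _ => ?_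
    exact integral_triangle_upper s b
      (hF.comp (f := fun p : ℝ × ℝ => (p.1, s, p.2)) (by fun_prop))
  | 2, 1 =>
    refine ⟨![fun _ _ _ => 0, fun s t f => ∫ x in t..s, f x, fun _ _ _ => 0],
      Fin.forall_fin_succ.2 ⟨z, Fin.forall_fin_two.2 ⟨.interval hsnd hfst, z⟩⟩, fun F hF => ?_⟩
    simp only [Fin.sum_univ_three, partInt, cons_val, intervalIntegral.integral_zero, zero_add,
      add_zero]
    rw [integral_triangle_upper a b (continuous_intervalIntegral (by fun_prop) (by fun_prop)
      (hF.comp (f := fun p : (ℝ × ℝ) × ℝ => (p.1.1, p.1.2, p.2)) (by fun_prop)))]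
    refine intervalIntegral.integral_congr fun s _ => ?_
    exact integral_triangle a s
      (hF.comp (f := fun p : ℝ × ℝ => (p.1, s, p.2)) (by fun_prop))
  | 1, 1 =>
    refine ⟨![fun _ _ _ => 0, fun s _ f => ∫ x in s..b, f x, fun _ t f => ∫ x in t..b, f x],
      Fin.forall_fin_succ.2 ⟨z, Fin.forall_fin_two.2 ⟨.interval hfst (hc b),
        .interval hsnd (hc b)⟩⟩, fun F hF => ?_⟩
    simp only [Fin.sum_univ_three, partInt, cons_val, zero_add]
    rw [integral_triangle a b (continuous_intervalIntegral (by fun_prop) (by fun_prop)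
      (hF.comp (f := fun p : (ℝ × ℝ) × ℝ => (p.1.1, p.1.2, p.2)) (by fun_prop)))]
    refine intervalIntegral.integral_congr fun s _ => ?_
    have hFs : Continuous fun p : ℝ × ℝ => F p.1 s p.2 :=
      hF.comp (f := fun p : ℝ × ℝ => (p.1, s, p.2)) (by fun_prop)
    have hFx (x : ℝ) : Continuous fun t => F x s t := hFs.comp (by fun_prop : Continuous (x, ·))
    have split (x : ℝ) : ∫ t in a..x, F x s t = (∫ t in a..s, F x s t) + ∫ t in s..x, F x s t :=
      (intervalIntegral.integral_add_adjacent_intervals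
        ((hFx x).intervalIntegrable _ _) ((hFx x).intervalIntegrable _ _)).symm
    simp only [split]
    rw [intervalIntegral.integral_add, integral_triangle s b hFs,
      intervalIntegral_swap_of_continuous hFs]
    all_goals
      exact (continuous_intervalIntegral (by fun_prop) (by fun_prop) hFs).intervalIntegrable _ _
  | 2, 2 =>
    refine ⟨![fun _ _ _ => 0, fun _ t f => ∫ x in a..t, f x, fun s _ f => ∫ x in a..s, f x],
      Fin.forall_fin_succ.2 ⟨z, Fin.forall_fin_two.2 ⟨.interval (hc a) hsnd,
        .interval (hc a) hfst⟩⟩, fun F hF => ?_⟩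
    simp only [Fin.sum_univ_three, partInt, cons_val, zero_add]
    rw [integral_triangle_upper a b (continuous_intervalIntegral (by fun_prop) (by fun_prop)
      (hF.comp (f := fun p : (ℝ × ℝ) × ℝ => (p.1.1, p.1.2, p.2)) (by fun_prop)))]
    refine intervalIntegral.integral_congr fun s _ => ?_
    have hFs : Continuous fun p : ℝ × ℝ => F p.1 s p.2 :=
      hF.comp (f := fun p : ℝ × ℝ => (p.1, s, p.2)) (by fun_prop)
    have hFx (x : ℝ) : Continuous fun t => F x s t := hFs.comp (by fun_prop : Continuous (x, ·))
    have split (x : ℝ) : ∫ t in x..b, F x s t = (∫ t in x..s, F x s t) + ∫ t in s..b, F x s t :=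
      (intervalIntegral.integral_add_adjacent_intervals
        ((hFx x).intervalIntegrable _ _) ((hFx x).intervalIntegrable _ _)).symm
    simp only [split]
    rw [intervalIntegral.integral_add, integral_triangle_upper a s hFs,
      intervalIntegral_swap_of_continuous hFs]
    all_goals
      exact (continuous_intervalIntegral (by fun_prop) (by fun_prop) hFs).intervalIntegrable _ _

@[fun_prop]
theorem Continuous.partInt {X : Type*} [TopologicalSpace X] (a b : ℝ) (α : Fin 3) [CompleteSpace E]
    {x : X → ℝ} {f : X → ℝ → E} (hx : Continuous x) (hf : Continuous fun p : X × ℝ => f p.1 p.2) :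
    Continuous fun p => partInt a b α (x p) (f p) := by
  obtain ⟨w, l, r, hw, hl, hr, h⟩ := exists_partInt_eq_segInt (E := E) a b α
  simp only [h]
  fun_prop

theorem partInt_mul_const (a b : ℝ) (α : Fin 3) (x : ℝ) (f : ℝ → ℝ) (r : ℝ) :
    partInt a b α x (fun t => f t * r) = partInt a b α x f * r := by
  obtain ⟨w, l, r, -, -, -, h⟩ := exists_partInt_eq_segInt (E := ℝ) a b α
  simp only [h, segInt_mul_const]

theorem partInt_sum {ι : Type*} (A : Finset ι) (a b : ℝ) (α : Fin 3) (x : ℝ) (f : ι → ℝ → ℝ)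
    (hf : ∀ i ∈ A, Continuous (f i)) :
    partInt a b α x (fun t => ∑ i ∈ A, f i t) = ∑ i ∈ A, partInt a b α x (f i) := by
  obtain ⟨w, l, r, -, -, -, h⟩ := exists_partInt_eq_segInt (E := ℝ) a b α
  simp only [h, segInt_sum A _ _ _ f hf]

theorem segInt_partInt_swap (w l r a b : ℝ) (α : Fin 3) (x : ℝ) {f : ℝ → ℝ → ℝ}
    (hf : Continuous fun p : ℝ × ℝ => f p.1 p.2) :
    segInt w l r (fun s => partInt a b α x fun t => f s t) =
      partInt a b α x fun t => segInt w l r fun s => f s t := by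
  obtain ⟨w, l, r, -, -, -, h⟩ := exists_partInt_eq_segInt (E := ℝ) a b α
  simp only [h]
  exact segInt_swap _ _ _ _ _ _ hf

theorem partInt_swap (a b : ℝ) (α : Fin 3) (x c d : ℝ) (β : Fin 3) (y : ℝ) {f : ℝ → ℝ → ℝ}
    (hf : Continuous fun p : ℝ × ℝ => f p.1 p.2) :
    partInt a b α x (fun s => partInt c d β y fun t => f s t) =
      partInt c d β y fun t => partInt a b α x fun s => f s t := by
  obtain ⟨w, l, r, -, -, -, h⟩ := exists_partInt_eq_segInt (E := ℝ) a b α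
  simp only [h]
  exact segInt_partInt_swap _ _ _ _ _ _ _ hf

theorem integral_partInt_swap (c d a b : ℝ) (α : Fin 3) (x : ℝ) {f : ℝ → ℝ → ℝ}
    (hf : Continuous fun p : ℝ × ℝ => f p.1 p.2) :
    ∫ y in c..d, partInt a b α x (fun t => f y t) =
      partInt a b α x fun t => ∫ y in c..d, f y t :=
  partInt_swap c d 1 d a b α x hf

@[fun_prop]
theorem Continuous.intervalIntegral_param {X : Type*} [TopologicalSpace X] (c d : ℝ)
    {f : X → ℝ → ℝ} (hf : Continuous fun p : X × ℝ => f p.1 p.2) :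
    Continuous fun p => ∫ y in c..d, f p y :=
  continuous_intervalIntegral continuous_const continuous_const hf

theorem exists_integral_partInt_partInt_segInt (a b : ℝ) (α' α : Fin 3) :
    ∃ w l r : Fin 3 → ℝ × ℝ → ℝ, (∀ γ, Continuous (w γ)) ∧ (∀ γ, Continuous (l γ)) ∧
      (∀ γ, Continuous (r γ)) ∧
      ∀ F : ℝ × ℝ × ℝ → ℝ, Continuous F →
        ∫ x in a..b, partInt a b α' x (fun s => partInt a b α x fun t => F (x, s, t)) =
          ∫ s in a..b, ∑ γ, partInt a b γ s fun t =>
            segInt (w γ (s, t)) (l γ (s, t)) (r γ (s, t)) fun x => F (x, s, t) := by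
  obtain ⟨R, hR, h⟩ := exists_integral_partInt_partInt a b α' α
  choose w l r hw hl hr hwlr using hR
  refine ⟨w, l, r, hw, hl, hr, fun F hF => ?_⟩
  simpa only [hwlr] using h (fun x s t => F (x, s, t)) hF

/-- Two-dimensional version of `exists_integral_partInt_partInt_segInt`. -/
theorem exists_integral_integral_partInt (a b c d : ℝ) (α' β' α β : Fin 3) :
    ∃ w l r w' l' r' : Fin 3 → ℝ × ℝ → ℝ,
      ((∀ γ, Continuous (w γ)) ∧ (∀ γ, Continuous (l γ)) ∧ (∀ γ, Continuous (r γ)) ∧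
        (∀ γ, Continuous (w' γ)) ∧ (∀ γ, Continuous (l' γ)) ∧ (∀ γ, Continuous (r' γ))) ∧
      ∀ K : ℝ × ℝ × ℝ × ℝ × ℝ × ℝ → ℝ, Continuous K →
        ∫ x in a..b, ∫ y in c..d,
          partInt a b α' x (fun s => partInt c d β' y fun s' =>
            partInt a b α x fun t => partInt c d β y fun t' => K (x, y, s, s', t, t')) =
        ∫ s in a..b, ∫ s' in c..d, ∑ γ, ∑ δ,
          partInt a b γ s fun t => partInt c d δ s' fun t' =>
            segInt (w γ (s, t)) (l γ (s, t)) (r γ (s, t)) fun x =>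
              segInt (w' δ (s', t')) (l' δ (s', t')) (r' δ (s', t')) fun y =>
                K (x, y, s, s', t, t') := by
  obtain ⟨w, l, r, hw, hl, hr, hx⟩ := exists_integral_partInt_partInt_segInt a b α' α
  obtain ⟨w', l', r', hw', hl', hr', hy⟩ := exists_integral_partInt_partInt_segInt c d β' β
  refine ⟨w, l, r, w', l', r', ⟨hw, hl, hr, hw', hl', hr'⟩, fun K hK => ?_⟩
  calc
    _ = ∫ x in a..b, partInt a b α' x fun s => partInt a b α x fun t => ∫ y in c..d,
          partInt c d β' y fun s' => partInt c d β y fun t' => K (x, y, s, s', t, t') := by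
      refine intervalIntegral.integral_congr fun x _ => ?_
      rw [integral_partInt_swap _ _ _ _ _ _ (by fun_prop)]
      refine congrArg _ (funext fun s => ?_)
      rw [← integral_partInt_swap _ _ _ _ _ _ (by fun_prop)]
      refine intervalIntegral.integral_congr fun y _ => ?_
      exact partInt_swap _ _ _ _ _ _ _ _ (by fun_prop)
    _ = ∫ x in a..b, partInt a b α' x fun s => partInt a b α x fun t => ∫ s' in c..d,
          ∑ δ, partInt c d δ s' fun t' =>
            segInt (w' δ (s', t')) (l' δ (s', t')) (r' δ (s', t')) fun y =>
              K (x, y, s, s', t, t') := by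
      refine intervalIntegral.integral_congr fun x _ => ?_
      refine congrArg _ (funext fun s => congrArg _ (funext fun t => ?_))
      exact hy (fun p => K (x, p.1, s, p.2.1, t, p.2.2)) (by fun_prop)
    _ = ∫ s in a..b, ∑ γ, partInt a b γ s fun t =>
          segInt (w γ (s, t)) (l γ (s, t)) (r γ (s, t)) fun x => ∫ s' in c..d,
            ∑ δ, partInt c d δ s' fun t' =>
              segInt (w' δ (s', t')) (l' δ (s', t')) (r' δ (s', t')) fun y =>
                K (x, y, s, s', t, t') :=
      hx (fun p => ∫ s' in c..d, ∑ δ, partInt c d δ s' fun t' =>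
        segInt (w' δ (s', t')) (l' δ (s', t')) (r' δ (s', t')) fun y =>
          K (p.1, y, p.2.1, s', p.2.2, t')) (by fun_prop)
    _ = _ := by
      refine intervalIntegral.integral_congr fun s _ => ?_
      rw [intervalIntegral.integral_finsetSum
        fun γ _ => Continuous.intervalIntegrable (by fun_prop) _ _]
      refine Finset.sum_congr rfl fun γ _ => ?_
      calc
        _ = ∫ s' in c..d, partInt a b γ s fun t => ∑ δ, partInt c d δ s' fun t' =>
            segInt (w γ (s, t)) (l γ (s, t)) (r γ (s, t)) fun x =>
              segInt (w' δ (s', t')) (l' δ (s', t')) (r' δ (s', t')) fun y =>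
                K (x, y, s, s', t, t') := by
          rw [integral_partInt_swap _ _ _ _ _ _ (by fun_prop)]
          refine congrArg _ (funext fun t => ?_)
          refine (segInt_partInt_swap _ _ _ c d 1 d (by fun_prop)).trans ?_
          refine intervalIntegral.integral_congr fun s' _ => ?_
          rw [segInt_sum _ _ _ _ _ (fun δ _ => by fun_prop)]
          refine Finset.sum_congr rfl fun δ _ => ?_
          exact segInt_partInt_swap _ _ _ _ _ _ _ (by fun_prop)
        _ = _ := by
          refine intervalIntegral.integral_congr fun s' _ => ?_
          exact partInt_sum _ _ _ _ _ _ (fun δ _ => by fun_prop)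

theorem partInt_congr {a b : ℝ} (α : Fin 3) {x : ℝ} (hx : x ∈ Icc a b) {f g : ℝ → E}
    (h : ∀ t ∈ Icc a b, f t = g t) : partInt a b α x f = partInt a b α x g := by
  have ha : a ∈ Icc a b := left_mem_Icc.2 (hx.1.trans hx.2)
  have hb : b ∈ Icc a b := right_mem_Icc.2 (hx.1.trans hx.2)
  match α with
  | 0 => exact h x hx
  | 1 =>
    exact intervalIntegral.integral_congr fun t ht =>
      h t (ordConnected_Icc.uIcc_subset ha hx ht)
  | 2 =>
    exact intervalIntegral.integral_congr fun t ht =>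
      h t (ordConnected_Icc.uIcc_subset hx hb ht)

theorem partInt_apply {p : ℕ} (a b : ℝ) (α : Fin 3) (x : ℝ) {f : ℝ → Fin p → ℝ}
    (hf : Continuous f) (i : Fin p) :
    partInt a b α x f i = partInt a b α x fun t => f t i := by
  have key (s t : ℝ) : (∫ x in s..t, f x) i = ∫ x in s..t, f x i :=
    ((ContinuousLinearMap.proj (R := ℝ) (φ := fun _ : Fin p => ℝ) i).intervalIntegral_comp_comm
      (hf.intervalIntegrable s t)).symm
  match α with
  | 0 => rfl
  | 1 => exact key a x
  | 2 => exact key x b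

/-- A bilinear form on functions on the rectangle which is given by a scalar 2D-PI operator with
continuous kernels. -/
def IsPIForm (a b c d : ℝ) (B : (ℝ × ℝ → ℝ) → (ℝ × ℝ → ℝ) → ℝ) : Prop :=
  ∃ k : Fin 3 → Fin 3 → ℝ × ℝ × ℝ × ℝ → ℝ, (∀ γ δ, Continuous (k γ δ)) ∧
    ∀ v u, Continuous v → Continuous u →
      B v u = ∫ x in a..b, ∫ y in c..d, v (x, y) * ∑ γ, ∑ δ,
        partInt a b γ x fun s => partInt c d δ y fun t => k γ δ (x, y, s, t) * u (s, t)

theorem integral_integral_sum {ι : Type*} (A : Finset ι) (a b c d : ℝ) {f : ι → ℝ → ℝ → ℝ}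
    (hf : ∀ i ∈ A, Continuous fun p : ℝ × ℝ => f i p.1 p.2) :
    ∫ x in a..b, ∫ y in c..d, ∑ i ∈ A, f i x y =
      ∑ i ∈ A, ∫ x in a..b, ∫ y in c..d, f i x y := by
  rw [← intervalIntegral.integral_finsetSum]
  · refine intervalIntegral.integral_congr fun x _ => ?_
    refine intervalIntegral.integral_finsetSum fun i hi => Continuous.intervalIntegrable ?_ _ _
    exact (hf i hi).comp (f := fun y => (x, y)) (by fun_prop)
  · intro i hi
    have := hf i hi
    exact Continuous.intervalIntegrable (by fun_prop) _ _

theorem IsPIForm.sum {ι : Type*} (A : Finset ι) {a b c d : ℝ}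
    {B : ι → (ℝ × ℝ → ℝ) → (ℝ × ℝ → ℝ) → ℝ} (hB : ∀ i, IsPIForm a b c d (B i)) :
    IsPIForm a b c d fun v u => ∑ i ∈ A, B i v u := by
  choose k hk h using hB
  refine ⟨fun γ δ p => ∑ i ∈ A, k i γ δ p, fun γ δ => by fun_prop, fun v u hv hu => ?_⟩
  simp only [fun i => h i v u hv hu]
  rw [← integral_integral_sum A a b c d (fun i _ => by fun_prop)]
  refine intervalIntegral.integral_congr fun x _ => intervalIntegral.integral_congr fun y _ => ?_
  rw [← Finset.mul_sum, Finset.sum_comm]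
  refine congrArg _ (Finset.sum_congr rfl fun γ _ => ?_)
  rw [Finset.sum_comm]
  refine Finset.sum_congr rfl fun δ _ => ?_
  simp only [Finset.sum_mul]
  rw [← partInt_sum A _ _ _ _ _ (fun i _ => by fun_prop)]
  refine congrArg _ (funext fun s => ?_)
  exact (partInt_sum A _ _ _ _ _ (fun i _ => by fun_prop)).symm

theorem isPIForm_partInt_mul_partInt (a b c d : ℝ) (α' β' α β : Fin 3) {h : ℝ × ℝ → ℝ}
    {Y Z : ℝ × ℝ × ℝ × ℝ → ℝ} (hh : Continuous h) (hY : Continuous Y) (hZ : Continuous Z) :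
    IsPIForm a b c d fun v u => ∫ x in a..b, ∫ y in c..d,
      (partInt a b α' x fun s => partInt c d β' y fun t => Y (x, y, s, t) * v (s, t)) *
      ((partInt a b α x fun s => partInt c d β y fun t => Z (x, y, s, t) * u (s, t)) *
        h (x, y)) := by
  obtain ⟨w, l, r, w', l', r', ⟨hw, hl, hr, hw', hl', hr'⟩, H⟩ :=
    exists_integral_integral_partInt a b c d α' β' α β
  refine ⟨fun γ δ p =>
    segInt (w γ (p.1, p.2.2.1)) (l γ (p.1, p.2.2.1)) (r γ (p.1, p.2.2.1)) fun x =>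
      segInt (w' δ (p.2.1, p.2.2.2)) (l' δ (p.2.1, p.2.2.2)) (r' δ (p.2.1, p.2.2.2)) fun y =>
        Y (x, y, p.1, p.2.1) * Z (x, y, p.2.2.1, p.2.2.2) * h (x, y),
    fun γ δ => by fun_prop, fun v u hv hu => ?_⟩
  have := H (fun p => Y (p.1, p.2.1, p.2.2.1, p.2.2.2.1) *
    Z (p.1, p.2.1, p.2.2.2.2.1, p.2.2.2.2.2) * h (p.1, p.2.1) * u (p.2.2.2.2.1, p.2.2.2.2.2) *
    v (p.2.2.1, p.2.2.2.1)) (by fun_prop)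
  simp only [segInt_mul_const, partInt_mul_const] at this
  refine Eq.trans ?_ (this.trans ?_)
  · refine intervalIntegral.integral_congr fun x _ => intervalIntegral.integral_congr fun y _ => ?_
    simp only [← partInt_mul_const]
    refine congrArg _ (funext fun s => congrArg _ (funext fun s' => ?_))
    rw [mul_comm]
    simp only [← partInt_mul_const]
    refine congrArg _ (funext fun t => congrArg _ (funext fun t' => ?_))
    ring
  · refine intervalIntegral.integral_congr fun x _ => intervalIntegral.integral_congr fun y _ => ?_
    simp only [← Finset.sum_mul, mul_comm (v (x, y))]

/-- A weighted vector of scalar partial integral operators. -/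
def partIntVec {ι : Type*} {n : ℕ} (a b c d : ℝ) (σ τ : ι → Fin 3) (h : ℝ × ℝ → ℝ)
    (Z : ι → Fin n → ℝ × ℝ × ℝ × ℝ → ℝ) (u : Fin n → ℝ × ℝ → ℝ) (x y : ℝ) (i : ι) : ℝ :=
  h (x, y) * ∑ l, partInt a b (σ i) x fun s => partInt c d (τ i) y fun t =>
    Z i l (x, y, s, t) * u l (s, t)

theorem dotProduct_mulVec_smul_sum {ι κ : Type*} [Fintype ι] [Fintype κ] (P : Matrix ι ι ℝ)
    (r : ℝ) (V U : ι → κ → ℝ) :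
    (fun i => r * ∑ l, V i l) ⬝ᵥ P *ᵥ (fun j => r * ∑ m, U j m) =
      ∑ l, ∑ m, ∑ i, ∑ j, V i l * (U j m * (r * r * P i j)) := by
  rw [Finset.sum_comm_cycle]
  simp only [dotProduct, mulVec, Finset.mul_sum]
  refine Finset.sum_congr rfl fun i _ => ?_
  rw [Finset.sum_comm_cycle]
  refine Finset.sum_congr rfl fun j _ => ?_
  simp only [← Finset.mul_sum, ← Finset.sum_mul]
  ring

theorem exists_kernel_partIntVec {ι : Type*} [Fintype ι] {n : ℕ} (a b c d : ℝ) (σ τ : ι → Fin 3)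
    (P : Matrix ι ι ℝ) {h : ℝ × ℝ → ℝ} (hh : Continuous h)
    {Z : ι → Fin n → ℝ × ℝ × ℝ × ℝ → ℝ} (hZ : ∀ i l, Continuous (Z i l)) :
    ∃ k : Fin 3 → Fin 3 → Fin n → Fin n → ℝ × ℝ × ℝ × ℝ → ℝ, (∀ γ δ l m, Continuous (k γ δ l m)) ∧
      ∀ v u : Fin n → ℝ × ℝ → ℝ, (∀ l, Continuous (v l)) → (∀ l, Continuous (u l)) →
        (∫ x in a..b, ∫ y in c..d, ∑ l, v l (x, y) * ∑ m, ∑ γ, ∑ δ,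
          partInt a b γ x fun s => partInt c d δ y fun t =>
            k γ δ l m (x, y, s, t) * u m (s, t)) =
        ∫ x in a..b, ∫ y in c..d,
          partIntVec a b c d σ τ h Z v x y ⬝ᵥ P *ᵥ partIntVec a b c d σ τ h Z u x y := by
  have key (l m : Fin n) : IsPIForm a b c d fun v u => ∑ i, ∑ j, ∫ x in a..b, ∫ y in c..d,
      (partInt a b (σ i) x fun s => partInt c d (τ i) y fun t => Z i l (x, y, s, t) * v (s, t)) *
      ((partInt a b (σ j) x fun s => partInt c d (τ j) y fun t => Z j m (x, y, s, t) * u (s, t)) *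
        (h (x, y) * h (x, y) * P i j)) :=
    .sum _ fun i => .sum _ fun j => isPIForm_partInt_mul_partInt (h := fun p => h p * h p * P i j)
      a b c d (σ i) (τ i) (σ j) (τ j) (by fun_prop) (hZ i l) (hZ j m)
  choose k hk H using key
  refine ⟨fun γ δ l m => k l m γ δ, fun γ δ l m => hk l m γ δ, fun v u hv hu => ?_⟩
  unfold partIntVec
  simp only [Finset.mul_sum (Finset.univ : Finset (Fin n)) _ (v _ _), dotProduct_mulVec_smul_sum]
  rw [integral_integral_sum _ _ _ _ _ (fun l _ => by fun_prop),
    integral_integral_sum _ _ _ _ _ (fun l _ => by fun_prop)]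
  refine Finset.sum_congr rfl fun l _ => ?_
  rw [integral_integral_sum _ _ _ _ _ (fun m _ => by fun_prop),
    integral_integral_sum _ _ _ _ _ (fun m _ => by fun_prop)]
  refine Finset.sum_congr rfl fun m _ => ?_
  rw [← H l m (v l) (u m) (hv l) (hu m), integral_integral_sum _ _ _ _ _ (fun i _ => by fun_prop)]
  refine Finset.sum_congr rfl fun i _ => ?_
  exact (integral_integral_sum _ _ _ _ _ (fun j _ => by fun_prop)).symm

end PartialIntegrals

/-- The nearest point of `[a,b]`. -/
def clamp (a b x : ℝ) : ℝ := max a (min b x)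

@[fun_prop]
theorem continuous_clamp (a b : ℝ) : Continuous (clamp a b) := by
  unfold clamp
  fun_prop

theorem clamp_mem {a b : ℝ} (hab : a ≤ b) (x : ℝ) : clamp a b x ∈ Icc a b :=
  ⟨le_max_left _ _, max_le hab (min_le_left _ _)⟩

theorem clamp_of_mem {a b x : ℝ} (hx : x ∈ Icc a b) : clamp a b x = x := by
  rw [clamp, min_eq_right hx.2, max_eq_right hx.1]

theorem ContinuousOn.comp_clamp₂ {F : Type*} [TopologicalSpace F] {a b c d : ℝ} (hab : a ≤ b)
    (hcd : c ≤ d) {f : ℝ → ℝ → F}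
    (hf : ContinuousOn (fun p : ℝ × ℝ => f p.1 p.2) (Icc a b ×ˢ Icc c d)) :
    Continuous fun p : ℝ × ℝ => f (clamp a b p.1) (clamp c d p.2) :=
  hf.comp_continuous (f := fun p : ℝ × ℝ => (clamp a b p.1, clamp c d p.2)) (by fun_prop)
    fun p => ⟨clamp_mem hab _, clamp_mem hcd _⟩

section Kernels

variable {p r : ℕ}

/-- The nine kernels of a 2D-PI operator, regarded as functions of all four variables. The indices
`0, 1, 2` stand for evaluation, lower integral and upper integral. -/
def PI2DK.kernel (N : PI2DK p r) :
    Fin 3 → Fin 3 → ℝ → ℝ → ℝ → ℝ → Matrix (Fin p) (Fin r) ℝ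
  | 0, 0, x, y, _, _ => N.k00 x y
  | 1, 0, x, y, s, _ => N.k10 x y s
  | 2, 0, x, y, s, _ => N.k20 x y s
  | 0, 1, x, y, _, t => N.k01 x y t
  | 0, 2, x, y, _, t => N.k02 x y t
  | 1, 1, x, y, s, t => N.k11 x y s t
  | 2, 1, x, y, s, t => N.k21 x y s t
  | 1, 2, x, y, s, t => N.k12 x y s t
  | 2, 2, x, y, s, t => N.k22 x y s t

theorem PI2DK.IsCont.continuous_kernel_clamp {a b c d : ℝ} (hab : a ≤ b) (hcd : c ≤ d)
    {N : PI2DK p r} (hN : N.IsCont a b c d) (γ δ : Fin 3) :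
    Continuous fun z : ℝ × ℝ × ℝ × ℝ => N.kernel γ δ (clamp a b z.1) (clamp c d z.2.1)
      (clamp a b z.2.2.1) (clamp c d z.2.2.2) := by
  obtain ⟨h00, h10, h20, h01, h02, h11, h21, h12, h22⟩ := hN
  have ma := clamp_mem hab
  have mc := clamp_mem hcd
  have c0 : Continuous fun z : ℝ × ℝ × ℝ × ℝ => (clamp a b z.1, clamp c d z.2.1) := by fun_prop
  have c1 : Continuous fun z : ℝ × ℝ × ℝ × ℝ =>
      (clamp a b z.1, clamp c d z.2.1, clamp a b z.2.2.1) := by fun_prop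
  have c2 : Continuous fun z : ℝ × ℝ × ℝ × ℝ =>
      (clamp a b z.1, clamp c d z.2.1, clamp c d z.2.2.2) := by fun_prop
  have c3 : Continuous fun z : ℝ × ℝ × ℝ × ℝ =>
      (clamp a b z.1, clamp c d z.2.1, clamp a b z.2.2.1, clamp c d z.2.2.2) := by fun_prop
  match γ, δ with
  | 0, 0 => exact h00.comp_continuous c0 fun z => ⟨ma _, mc _⟩
  | 1, 0 => exact h10.comp_continuous c1 fun z => ⟨ma _, mc _, ma _⟩
  | 2, 0 => exact h20.comp_continuous c1 fun z => ⟨ma _, mc _, ma _⟩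
  | 0, 1 => exact h01.comp_continuous c2 fun z => ⟨ma _, mc _, mc _⟩
  | 0, 2 => exact h02.comp_continuous c2 fun z => ⟨ma _, mc _, mc _⟩
  | 1, 1 => exact h11.comp_continuous c3 fun z => ⟨ma _, mc _, ma _, mc _⟩
  | 2, 1 => exact h21.comp_continuous c3 fun z => ⟨ma _, mc _, ma _, mc _⟩
  | 1, 2 => exact h12.comp_continuous c3 fun z => ⟨ma _, mc _, ma _, mc _⟩
  | 2, 2 => exact h22.comp_continuous c3 fun z => ⟨ma _, mc _, ma _, mc _⟩

/-- The 2D-PI kernels obtained from nine functions of four variables, restricting those which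
belong to evaluations to the diagonal. -/
def PI2DK.ofKernel (M : Fin 3 → Fin 3 → ℝ × ℝ × ℝ × ℝ → Matrix (Fin p) (Fin r) ℝ) :
    PI2DK p r where
  k00 x y := M 0 0 (x, y, x, y)
  k10 x y s := M 1 0 (x, y, s, y)
  k20 x y s := M 2 0 (x, y, s, y)
  k01 x y t := M 0 1 (x, y, x, t)
  k02 x y t := M 0 2 (x, y, x, t)
  k11 x y s t := M 1 1 (x, y, s, t)
  k21 x y s t := M 2 1 (x, y, s, t)
  k12 x y s t := M 1 2 (x, y, s, t)
  k22 x y s t := M 2 2 (x, y, s, t)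

theorem PI2DK.isCont_ofKernel {M : Fin 3 → Fin 3 → ℝ × ℝ × ℝ × ℝ → Matrix (Fin p) (Fin r) ℝ}
    (hM : ∀ γ δ, Continuous (M γ δ)) (a b c d : ℝ) : (PI2DK.ofKernel M).IsCont a b c d := by
  refine ⟨?_, ?_, ?_, ?_, ?_, ?_, ?_, ?_, ?_⟩ <;>
  · refine Continuous.continuousOn ?_
    dsimp only [PI2DK.ofKernel]
    fun_prop

theorem PI2D_ofKernel (M : Fin 3 → Fin 3 → ℝ × ℝ × ℝ × ℝ → Matrix (Fin p) (Fin r) ℝ)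
    (a b c d : ℝ) (u : ℝ → ℝ → Fin r → ℝ) (x y : ℝ) :
    PI2D a b c d (PI2DK.ofKernel M) u x y = ∑ γ, ∑ δ, partInt a b γ x fun s =>
      partInt c d δ y fun t => M γ δ (x, y, s, t) *ᵥ u s t := by
  simp only [Fin.sum_univ_three, partInt, PI2D, PI2DK.ofKernel]
  abel

theorem partInt_partInt_mulVec_apply {a b c d x y : ℝ} (hx : x ∈ Icc a b) (hy : y ∈ Icc c d)
    (γ δ : Fin 3) {M : ℝ → ℝ → Matrix (Fin p) (Fin r) ℝ} {u : ℝ → ℝ → Fin r → ℝ}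
    {M' : ℝ × ℝ → Matrix (Fin p) (Fin r) ℝ} {u' : Fin r → ℝ × ℝ → ℝ}
    (hM' : Continuous M') (hu' : ∀ l, Continuous (u' l))
    (hM : ∀ s ∈ Icc a b, ∀ t ∈ Icc c d, M s t = M' (s, t))
    (hu : ∀ s ∈ Icc a b, ∀ t ∈ Icc c d, ∀ l, u s t l = u' l (s, t)) (i : Fin p) :
    (partInt a b γ x fun s => partInt c d δ y fun t => M s t *ᵥ u s t) i =
      ∑ l, partInt a b γ x fun s => partInt c d δ y fun t => M' (s, t) i l * u' l (s, t) := by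
  have hc : Continuous fun z => M' z *ᵥ fun l => u' l z :=
    hM'.matrix_mulVec (continuous_pi hu')
  have hMi (l : Fin r) : Continuous fun z => M' z i l := hM'.matrix_elem i l
  calc
    _ = (partInt a b γ x fun s => partInt c d δ y fun t =>
          M' (s, t) *ᵥ fun l => u' l (s, t)) i := by
      refine congrFun (partInt_congr γ hx fun s hs => partInt_congr δ hy fun t ht => ?_) i
      rw [hM s hs t ht, funext (hu s hs t ht)]
    _ = partInt a b γ x fun s => partInt c d δ y fun t => ∑ l, M' (s, t) i l * u' l (s, t) := by
      rw [partInt_apply _ _ _ _ (by fun_prop)]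
      refine congrArg _ (funext fun s => ?_)
      rw [partInt_apply _ _ _ _ (by fun_prop)]
      rfl
    _ = _ := by
      rw [← partInt_sum _ _ _ _ _ _ (fun l _ => by fun_prop)]
      refine congrArg _ (funext fun s => ?_)
      exact partInt_sum _ _ _ _ _ _ (fun l _ => by fun_prop)

end Kernels

theorem Zop_apply {n q : ℕ} (a b c d : ℝ) (g : ℝ → ℝ → ℝ) (Z : PI2DK q n)
    (u : ℝ → ℝ → Fin n → ℝ) (x y : ℝ) (i : Fin 9 × Fin q) :
    Zop a b c d g Z.k00 Z.k10 Z.k20 Z.k01 Z.k02 Z.k11 Z.k21 Z.k12 Z.k22 u x y i =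
      √(g x y) * (partInt a b (![0, 1, 2, 0, 0, 1, 2, 1, 2] i.1) x fun s =>
        partInt c d (![0, 0, 0, 1, 2, 1, 1, 2, 2] i.1) y fun t =>
          Z.kernel (![0, 1, 2, 0, 0, 1, 2, 1, 2] i.1) (![0, 0, 0, 1, 2, 1, 1, 2, 2] i.1)
            x y s t *ᵥ u s t) i.2 := by
  obtain ⟨i, k⟩ := i
  fin_cases i <;> rfl

theorem intervalIntegral_congr_Icc {a b c d : ℝ} (hab : a ≤ b) (hcd : c ≤ d)
    {f g : ℝ → ℝ → ℝ} (h : ∀ x ∈ Icc a b, ∀ y ∈ Icc c d, f x y = g x y) :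
    (∫ x in a..b, ∫ y in c..d, f x y) = ∫ x in a..b, ∫ y in c..d, g x y := by
  refine intervalIntegral.integral_congr fun x hx => intervalIntegral.integral_congr fun y hy => ?_
  rw [uIcc_of_le hab] at hx
  rw [uIcc_of_le hcd] at hy
  exact h x hx y hy

theorem exists_PI2D_eq_Zop {n q : ℕ} {a b c d : ℝ} (hab : a ≤ b) (hcd : c ≤ d) {g : ℝ → ℝ → ℝ}
    (hg : ContinuousOn (fun p : ℝ × ℝ => g p.1 p.2) (Icc a b ×ˢ Icc c d))
    {Z : PI2DK q n} (hZ : Z.IsCont a b c d) (P : Matrix (Fin 9 × Fin q) (Fin 9 × Fin q) ℝ) :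
    ∃ N : PI2DK n n, N.IsCont a b c d ∧ ∀ u v : ℝ → ℝ → Fin n → ℝ,
      ContinuousOn (fun p : ℝ × ℝ => u p.1 p.2) (Icc a b ×ˢ Icc c d) →
      ContinuousOn (fun p : ℝ × ℝ => v p.1 p.2) (Icc a b ×ˢ Icc c d) →
      (∫ x in a..b, ∫ y in c..d, v x y ⬝ᵥ PI2D a b c d N u x y) = ∫ x in a..b, ∫ y in c..d,
        Zop a b c d g Z.k00 Z.k10 Z.k20 Z.k01 Z.k02 Z.k11 Z.k21 Z.k12 Z.k22 v x y ⬝ᵥ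
          P *ᵥ Zop a b c d g Z.k00 Z.k10 Z.k20 Z.k01 Z.k02 Z.k11 Z.k21 Z.k12 Z.k22 u x y := by
  let σ : Fin 9 × Fin q → Fin 3 := fun i => ![0, 1, 2, 0, 0, 1, 2, 1, 2] i.1
  let τ : Fin 9 × Fin q → Fin 3 := fun i => ![0, 0, 0, 1, 2, 1, 1, 2, 2] i.1
  let h : ℝ × ℝ → ℝ := fun p => √(g (clamp a b p.1) (clamp c d p.2))
  let K : Fin 3 → Fin 3 → ℝ × ℝ × ℝ × ℝ → Matrix (Fin q) (Fin n) ℝ := fun γ δ z =>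
    Z.kernel γ δ (clamp a b z.1) (clamp c d z.2.1) (clamp a b z.2.2.1) (clamp c d z.2.2.2)
  let Z' : Fin 9 × Fin q → Fin n → ℝ × ℝ × ℝ × ℝ → ℝ := fun i l z => K (σ i) (τ i) z i.2 l
  let ext : (ℝ → ℝ → Fin n → ℝ) → Fin n → ℝ × ℝ → ℝ := fun u l p =>
    u (clamp a b p.1) (clamp c d p.2) l
  have hK (γ δ) : Continuous (K γ δ) := hZ.continuous_kernel_clamp hab hcd γ δ
  have hext {u : ℝ → ℝ → Fin n → ℝ}
      (hu : ContinuousOn (fun p : ℝ × ℝ => u p.1 p.2) (Icc a b ×ˢ Icc c d)) (l : Fin n) :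
      Continuous (ext u l) := (continuous_apply l).comp (hu.comp_clamp₂ hab hcd)
  have hext_apply (u : ℝ → ℝ → Fin n → ℝ) : ∀ s ∈ Icc a b, ∀ t ∈ Icc c d, ∀ l,
      u s t l = ext u l (s, t) := fun s hs t ht l => by
    simp only [ext, clamp_of_mem hs, clamp_of_mem ht]
  have hZop {u : ℝ → ℝ → Fin n → ℝ}
      (hu : ContinuousOn (fun p : ℝ × ℝ => u p.1 p.2) (Icc a b ×ˢ Icc c d)) {x y : ℝ}
      (hx : x ∈ Icc a b) (hy : y ∈ Icc c d) :
      Zop a b c d g Z.k00 Z.k10 Z.k20 Z.k01 Z.k02 Z.k11 Z.k21 Z.k12 Z.k22 u x y =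
        partIntVec a b c d σ τ h Z' (ext u) x y := by
    ext i
    rw [Zop_apply, partIntVec]
    congr 1
    · simp only [h, clamp_of_mem hx, clamp_of_mem hy]
    · refine partInt_partInt_mulVec_apply (M' := fun z => K (σ i) (τ i) (x, y, z)) hx hy _ _
        ((hK _ _).comp (by fun_prop)) (hext hu) (fun s hs t ht => ?_) (hext_apply u) _
      simp only [K, clamp_of_mem hx, clamp_of_mem hy, clamp_of_mem hs, clamp_of_mem ht, σ, τ]
  obtain ⟨k, hk, hkform⟩ := exists_kernel_partIntVec a b c d σ τ P
    (h := h) (Real.continuous_sqrt.comp (hg.comp_clamp₂ hab hcd))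
    (Z := Z') fun i l => (hK _ _).matrix_elem i.2 l
  have hM (γ δ) : Continuous fun z => Matrix.of fun l m => k γ δ l m z :=
    continuous_matrix fun l m => hk γ δ l m
  refine ⟨.ofKernel fun γ δ z => Matrix.of fun l m => k γ δ l m z,
    PI2DK.isCont_ofKernel hM a b c d, fun u v hu hv => ?_⟩
  calc
    _ = ∫ x in a..b, ∫ y in c..d, ∑ l, ext v l (x, y) * ∑ m, ∑ γ, ∑ δ,
          partInt a b γ x fun s => partInt c d δ y fun t =>
            k γ δ l m (x, y, s, t) * ext u m (s, t) := by
      refine intervalIntegral_congr_Icc hab hcd fun x hx y hy => ?_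
      refine Finset.sum_congr rfl fun l _ => ?_
      rw [hext_apply v x hx y hy, PI2D_ofKernel, Finset.sum_apply, Finset.sum_comm]
      congr 1
      refine Finset.sum_congr rfl fun γ _ => ?_
      rw [Finset.sum_apply, Finset.sum_comm]
      refine Finset.sum_congr rfl fun δ _ => ?_
      exact partInt_partInt_mulVec_apply
        (M' := fun z => Matrix.of fun l m => k γ δ l m (x, y, z)) hx hy _ _
        ((hM γ δ).comp (by fun_prop)) (hext hu) (fun _ _ _ _ => rfl) (hext_apply u) l
    _ = _ := hkform _ _ (hext hv) (hext hu)
    _ = _ := intervalIntegral_congr_Icc hab hcd fun x hx y hy => by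
      rw [hZop hu hx hy, hZop hv hx hy]

/-- Parameterization of positive 2D-PI operators: for every symmetric
positive-semidefinite matrix `P` there is a family of 2D-PI kernels `N` with
`P[N] = 𝒵* P 𝒵` weakly; in particular `P[N]` is self-adjoint and positive semidefinite
on `L²` of the rectangle. -/
theorem positive_2D_PI_operator_parameterization {n q : ℕ} (a b c d : ℝ)
    (hab : a < b) (hcd : c < d)
    (g : ℝ → ℝ → ℝ)
    (hg : ContinuousOn (fun p : ℝ × ℝ => g p.1 p.2) (Icc a b ×ˢ Icc c d))
    (hg0 : ∀ x ∈ Icc a b, ∀ y ∈ Icc c d, 0 ≤ g x y)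
    (Z1 : ℝ → ℝ → Matrix (Fin q) (Fin n) ℝ)
    (Z2 Z3 Z4 Z5 : ℝ → ℝ → ℝ → Matrix (Fin q) (Fin n) ℝ)
    (Z6 Z7 Z8 Z9 : ℝ → ℝ → ℝ → ℝ → Matrix (Fin q) (Fin n) ℝ)
    (hZ1 : ContinuousOn (fun p : ℝ × ℝ => Z1 p.1 p.2) (Icc a b ×ˢ Icc c d))
    (hZ2 : ContinuousOn (fun p : ℝ × ℝ × ℝ => Z2 p.1 p.2.1 p.2.2)
      (Icc a b ×ˢ Icc c d ×ˢ Icc a b))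
    (hZ3 : ContinuousOn (fun p : ℝ × ℝ × ℝ => Z3 p.1 p.2.1 p.2.2)
      (Icc a b ×ˢ Icc c d ×ˢ Icc a b))
    (hZ4 : ContinuousOn (fun p : ℝ × ℝ × ℝ => Z4 p.1 p.2.1 p.2.2)
      (Icc a b ×ˢ Icc c d ×ˢ Icc c d))
    (hZ5 : ContinuousOn (fun p : ℝ × ℝ × ℝ => Z5 p.1 p.2.1 p.2.2)
      (Icc a b ×ˢ Icc c d ×ˢ Icc c d))
    (hZ6 : ContinuousOn (fun p : ℝ × ℝ × ℝ × ℝ => Z6 p.1 p.2.1 p.2.2.1 p.2.2.2)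
      (Icc a b ×ˢ Icc c d ×ˢ Icc a b ×ˢ Icc c d))
    (hZ7 : ContinuousOn (fun p : ℝ × ℝ × ℝ × ℝ => Z7 p.1 p.2.1 p.2.2.1 p.2.2.2)
      (Icc a b ×ˢ Icc c d ×ˢ Icc a b ×ˢ Icc c d))
    (hZ8 : ContinuousOn (fun p : ℝ × ℝ × ℝ × ℝ => Z8 p.1 p.2.1 p.2.2.1 p.2.2.2)
      (Icc a b ×ˢ Icc c d ×ˢ Icc a b ×ˢ Icc c d))
    (hZ9 : ContinuousOn (fun p : ℝ × ℝ × ℝ × ℝ => Z9 p.1 p.2.1 p.2.2.1 p.2.2.2)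
      (Icc a b ×ˢ Icc c d ×ˢ Icc a b ×ˢ Icc c d))
    (P : Matrix (Fin 9 × Fin q) (Fin 9 × Fin q) ℝ)
    (hPsym : Pᵀ = P)
    (hPpsd : ∀ w : Fin 9 × Fin q → ℝ, 0 ≤ w ⬝ᵥ P *ᵥ w) :
    ∃ N : PI2DK n n, N.IsCont a b c d ∧
      (∀ u v : ℝ → ℝ → Fin n → ℝ,
        ContinuousOn (fun p : ℝ × ℝ => u p.1 p.2) (Icc a b ×ˢ Icc c d) →
        ContinuousOn (fun p : ℝ × ℝ => v p.1 p.2) (Icc a b ×ˢ Icc c d) →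
        (∫ x in a..b, ∫ y in c..d, v x y ⬝ᵥ PI2D a b c d N u x y)
          = ∫ x in a..b, ∫ y in c..d,
              Zop a b c d g Z1 Z2 Z3 Z4 Z5 Z6 Z7 Z8 Z9 v x y ⬝ᵥ
                (P *ᵥ Zop a b c d g Z1 Z2 Z3 Z4 Z5 Z6 Z7 Z8 Z9 u x y)) ∧
      (∀ u v : ℝ → ℝ → Fin n → ℝ,
        ContinuousOn (fun p : ℝ × ℝ => u p.1 p.2) (Icc a b ×ˢ Icc c d) →
        ContinuousOn (fun p : ℝ × ℝ => v p.1 p.2) (Icc a b ×ˢ Icc c d) →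
        (∫ x in a..b, ∫ y in c..d, v x y ⬝ᵥ PI2D a b c d N u x y)
          = ∫ x in a..b, ∫ y in c..d, PI2D a b c d N v x y ⬝ᵥ u x y) ∧
      (∀ u : ℝ → ℝ → Fin n → ℝ,
        ContinuousOn (fun p : ℝ × ℝ => u p.1 p.2) (Icc a b ×ˢ Icc c d) →
        0 ≤ ∫ x in a..b, ∫ y in c..d, u x y ⬝ᵥ PI2D a b c d N u x y) := by
  obtain ⟨N, hN, hform⟩ := exists_PI2D_eq_Zop hab.le hcd.le hg
    (Z := ⟨Z1, Z2, Z3, Z4, Z5, Z6, Z7, Z8, Z9⟩)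
    ⟨hZ1, hZ2, hZ3, hZ4, hZ5, hZ6, hZ7, hZ8, hZ9⟩ P
  refine ⟨N, hN, hform, fun u v hu hv => ?_, fun u hu => ?_⟩
  · simp only [dotProduct_comm (PI2D a b c d N v _ _)]
    rw [hform u v hu hv, hform v u hv hu]
    refine intervalIntegral_congr_Icc hab.le hcd.le fun x _ y _ => ?_
    rw [dotProduct_mulVec, ← mulVec_transpose, hPsym, dotProduct_comm]
  · rw [hform u u hu hu]
    exact intervalIntegral.integral_nonneg hab.le fun x _ =>
      intervalIntegral.integral_nonneg hcd.le fun y _ => hPpsd _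
end
end
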